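/- arXiv:1201.4572 — 3 statements merged into one kernel-verified Lean document; each statement's English description precedes it below -/
import Mathlib

section
/- Let ν be a partition of n−1 (n ≥ 1). Then n · f_ν = Σ_μ f_μ · (1 − 2·c(μ/ν)), where the sum runs over all partitions μ of n whose Young diagram contains the Young diagram of ν (so μ is obtained from ν by adding one box), f_λ denotes the number of standard Young tableaux of shape λ, and c(μ/ν) = j − i is the content of the unique box (i,j) of μ not in ν. -/
open Finset

/-- The number of standard Young tableaux of shape `μ`: bijective fillings of the
cells of `μ` with the numbers `0, 1, …, |μ| - 1` (equivalently `1, 2, …, |μ|`) that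
strictly increase along each row (left to right) and down each column, encoded as
injective maps `μ.cells → Fin μ.card` that are strictly increasing in the
coordinatewise order on cells. -/
noncomputable def sytCount (μ : YoungDiagram) : ℕ :=
  Nat.card {T : μ.cells → Fin μ.card //
    Function.Injective T ∧
    ∀ c d : μ.cells, (c : ℕ × ℕ).1 ≤ (d : ℕ × ℕ).1 → (c : ℕ × ℕ).2 ≤ (d : ℕ × ℕ).2 →
      c ≠ d → T c < T d}

section LinearExtensions

variable {α : Type*} [PartialOrder α]

/-- The linear extensions of a finite set `s`, normalized to vanish outside `s`. -/
def linearExtensions (s : Finset α) : Set (α → ℕ) :=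
  {T | (∀ x ∈ s, T x < #s) ∧ Set.InjOn T s ∧ StrictMonoOn T s ∧ ∀ x ∉ s, T x = 0}

/-- The maximal elements of a finite set. -/
noncomputable def maximals (s : Finset α) : Finset α := by
  classical exact {b ∈ s | ∀ x ∈ s, ¬ b < x}

theorem mem_maximals {s : Finset α} {b : α} : b ∈ maximals s ↔ b ∈ s ∧ ∀ x ∈ s, ¬ b < x := by
  simp [maximals]

/-- Linear extensions as maps into `Fin #s`. -/
def linearExtensionsEquiv (s : Finset α) [DecidableEq α] :
    {T : s → Fin #s // Function.Injective T ∧ StrictMono T} ≃ linearExtensions s where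
  toFun T := ⟨fun x => if h : x ∈ s then T.1 ⟨x, h⟩ else 0, by
    obtain ⟨T, hT, hm⟩ := T
    refine ⟨fun x hx => ?_, fun x hx y hy h => ?_, fun x hx y hy h => ?_, fun x hx => ?_⟩
    · simp [hx]
    · simp only [mem_coe] at hx hy
      simpa [hx, hy, Fin.val_inj, hT.eq_iff] using h
    · simp only [mem_coe] at hx hy
      simpa [hx, hy] using hm (show (⟨x, hx⟩ : s) < ⟨y, hy⟩ from h)
    · simp [hx]⟩
  invFun T := ⟨fun x => ⟨T.1 x, T.2.1 x x.2⟩,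
    fun x y h => Subtype.ext (T.2.2.1 x.2 y.2 (by simpa using h)),
    fun x y h => by simpa using T.2.2.2.1 x.2 y.2 h⟩
  left_inv T := by ext x; simp
  right_inv T := by
    ext x
    by_cases hx : x ∈ s
    · simp [hx]
    · simp [hx, T.2.2.2.2 x hx]

instance (s : Finset α) : Finite (linearExtensions s) := by
  classical exact Finite.of_equiv _ (linearExtensionsEquiv s)

theorem exists_mem_maximals_of_mem_linearExtensions {s : Finset α} (hs : s.Nonempty) {T : α → ℕ}
    (hT : T ∈ linearExtensions s) : ∃ b ∈ maximals s, T b + 1 = #s := by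
  have hpos := hs.card_pos
  have himg : s.image T = range #s :=
    eq_of_subset_of_card_le (fun y hy => by
      obtain ⟨x, hx, rfl⟩ := mem_image.1 hy
      exact mem_range.2 (hT.1 x hx)) (by rw [card_range, card_image_of_injOn hT.2.1])
  have hmem : #s - 1 ∈ s.image T := by rw [himg, mem_range]; omega
  obtain ⟨b, hb, hTb⟩ := mem_image.1 hmem
  refine ⟨b, mem_maximals.2 ⟨hb, fun x hx hlt => ?_⟩, by omega⟩
  have h1 := hT.2.2.1 hb hx hlt
  have h2 := hT.1 x hx
  omega

variable [DecidableEq α]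

theorem update_zero_mem_linearExtensions {s : Finset α} {T : α → ℕ} {b : α}
    (hT : T ∈ linearExtensions s) (hb : b ∈ s) (hTb : T b + 1 = #s) :
    Function.update T b 0 ∈ linearExtensions (s.erase b) := by
  obtain ⟨h1, h2, h3, h4⟩ := hT
  have hcard := card_erase_of_mem hb
  refine ⟨fun x hx => ?_, fun x hx y hy h => ?_, fun x hx y hy h => ?_, fun x hx => ?_⟩
  · obtain ⟨hxb, hxs⟩ := mem_erase.1 hx
    rw [Function.update_of_ne hxb]
    have hlt := h1 x hxs
    have hne : T x ≠ T b := fun h => hxb (h2 hxs hb h)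
    omega
  · obtain ⟨hxb, hxs⟩ := mem_erase.1 (mem_coe.1 hx)
    obtain ⟨hyb, hys⟩ := mem_erase.1 (mem_coe.1 hy)
    rw [Function.update_of_ne hxb, Function.update_of_ne hyb] at h
    exact h2 hxs hys h
  · obtain ⟨hxb, hxs⟩ := mem_erase.1 (mem_coe.1 hx)
    obtain ⟨hyb, hys⟩ := mem_erase.1 (mem_coe.1 hy)
    rw [Function.update_of_ne hxb, Function.update_of_ne hyb]
    exact h3 hxs hys h
  · by_cases hxb : x = b
    · simp [hxb]
    · rw [Function.update_of_ne hxb]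
      exact h4 x fun h => hx (mem_erase.2 ⟨hxb, h⟩)

theorem update_card_mem_linearExtensions {s : Finset α} {T : α → ℕ} {b : α}
    (hb : b ∈ maximals s) (hT : T ∈ linearExtensions (s.erase b)) :
    Function.update T b (#s - 1) ∈ linearExtensions s := by
  obtain ⟨h1, h2, h3, h4⟩ := hT
  obtain ⟨hbs, hmax⟩ := mem_maximals.1 hb
  have hcard := card_erase_of_mem hbs
  have hpos : 0 < #s := card_pos.2 ⟨b, hbs⟩
  rw [hcard] at h1
  have hlt : ∀ x ∈ s, x ≠ b → T x < #s - 1 := fun x hx hxb => h1 x (mem_erase.2 ⟨hxb, hx⟩)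
  refine ⟨fun x hx => ?_, fun x hx y hy h => ?_, fun x hx y hy h => ?_, fun x hx => ?_⟩
  · by_cases hxb : x = b
    · subst hxb; rw [Function.update_self]; omega
    · rw [Function.update_of_ne hxb]
      have := hlt x hx hxb
      omega
  · rw [mem_coe] at hx hy
    by_cases hxb : x = b <;> by_cases hyb : y = b
    · rw [hxb, hyb]
    · rw [hxb, Function.update_self, Function.update_of_ne hyb] at h
      exact absurd h (hlt y hy hyb).ne'
    · rw [hyb, Function.update_self, Function.update_of_ne hxb] at h
      exact absurd h (hlt x hx hxb).ne
    · rw [Function.update_of_ne hxb, Function.update_of_ne hyb] at h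
      exact h2 (by simp [*]) (by simp [*]) h
  · rw [mem_coe] at hx hy
    have hxb : x ≠ b := by rintro rfl; exact hmax y hy h
    rw [Function.update_of_ne hxb]
    by_cases hyb : y = b
    · rw [hyb, Function.update_self]; exact hlt x hx hxb
    · rw [Function.update_of_ne hyb]
      exact h3 (by simp [*]) (by simp [*]) h
  · have hxb : x ≠ b := by rintro rfl; exact hx hbs
    rw [Function.update_of_ne hxb]
    exact h4 x (by simp [hx])

/-- Linear extensions of a nonempty finite set are classified by the position of their largest
value together with the linear extension of the remaining elements. -/
theorem card_linearExtensions {s : Finset α} (hs : s.Nonempty) :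
    Nat.card (linearExtensions s) =
      ∑ b ∈ maximals s, Nat.card (linearExtensions (s.erase b)) := by
  let φ : (Σ b : maximals s, linearExtensions (s.erase b)) → linearExtensions s := fun p =>
    ⟨Function.update p.2.1 p.1 (#s - 1), update_card_mem_linearExtensions p.1.2 p.2.2⟩
  have hφ : Function.Bijective φ := by
    constructor
    · rintro ⟨⟨b, hb⟩, T, hT⟩ ⟨⟨c, hc⟩, S, hS⟩ h
      have h' : Function.update T b (#s - 1) = Function.update S c (#s - 1) :=
        congrArg Subtype.val h
      obtain rfl : b = c := by
        refine (update_card_mem_linearExtensions hb hT).2.1 (mem_maximals.1 hb).1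
          (mem_maximals.1 hc).1 ?_
        rw [Function.update_self, h', Function.update_self]
      obtain rfl : T = S := by
        funext x
        by_cases hx : x = b
        · rw [hx, hT.2.2.2 b (by simp), hS.2.2.2 b (by simp)]
        · simpa [hx] using congrFun h' x
      rfl
    · rintro ⟨T, hT⟩
      obtain ⟨b, hb, hTb⟩ := exists_mem_maximals_of_mem_linearExtensions hs hT
      refine ⟨⟨⟨b, hb⟩, Function.update T b 0,
        update_zero_mem_linearExtensions hT (mem_maximals.1 hb).1 hTb⟩, Subtype.ext ?_⟩
      simp only [φ, Function.update_idem]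
      rw [← hTb, Nat.add_sub_cancel, Function.update_eq_self]
  rw [← Nat.card_congr (Equiv.ofBijective φ hφ), Nat.card_sigma,
    sum_coe_sort (maximals s) fun b => Nat.card (linearExtensions (s.erase b))]

end LinearExtensions

theorem sytCount_eq_card_linearExtensions (μ : YoungDiagram) :
    sytCount μ = Nat.card (linearExtensions μ.cells) := by
  rw [← Nat.card_congr (linearExtensionsEquiv μ.cells)]
  refine Nat.card_congr (Equiv.subtypeEquivRight fun T => and_congr_right fun _ => ?_)
  exact ⟨fun h c d hcd => h c d hcd.le.1 hcd.le.2 hcd.ne,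
    fun h c d h1 h2 hne => h (lt_of_le_of_ne ⟨h1, h2⟩ hne)⟩

namespace YoungDiagram

/-- The cells that can be added to a Young diagram. -/
noncomputable def addable (ν : YoungDiagram) : Finset (ℕ × ℕ) := by
  classical exact
    {a ∈ range (ν.colLen 0 + 1) ×ˢ range (ν.rowLen 0 + 1) | a ∉ ν ∧ ∀ x < a, x ∈ ν}

theorem mem_addable {ν : YoungDiagram} {a : ℕ × ℕ} :
    a ∈ ν.addable ↔ a ∉ ν ∧ ∀ x < a, x ∈ ν := by
  obtain ⟨i, j⟩ := a
  simp only [addable, mem_filter, mem_product, mem_range, and_iff_right_iff_imp]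
  rintro ⟨-, h⟩
  constructor
  · rcases i with _ | i
    · omega
    · have : (i, 0) ∈ ν := h _ (Prod.mk_lt_mk.2 (Or.inl ⟨by omega, by omega⟩))
      rw [mem_iff_lt_colLen] at this
      omega
  · rcases j with _ | j
    · omega
    · have : (0, j) ∈ ν := h _ (Prod.mk_lt_mk.2 (Or.inr ⟨by omega, by omega⟩))
      rw [mem_iff_lt_rowLen] at this
      omega

/-- The diagram obtained by adding an addable cell. -/
def insertCell (ν : YoungDiagram) (a : ℕ × ℕ) (ha : a ∈ ν.addable) : YoungDiagram where
  cells := insert a ν.cells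
  isLowerSet := by
    intro x y hyx hx
    simp only [coe_insert, Set.mem_insert_iff, mem_coe, mem_cells] at hx ⊢
    rcases hx with rfl | hx
    · exact hyx.eq_or_lt.imp_right ((mem_addable.1 ha).2 y)
    · exact Or.inr (ν.isLowerSet hyx hx)

/-- The diagram obtained by removing a corner. -/
def eraseCell (ν : YoungDiagram) (b : ℕ × ℕ) (hb : b ∈ maximals ν.cells) : YoungDiagram where
  cells := ν.cells.erase b
  isLowerSet := by
    intro x y hyx hx
    simp only [coe_erase, Set.mem_sdiff, mem_coe, Set.mem_singleton_iff] at hx ⊢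
    refine ⟨ν.isLowerSet hyx hx.1, ?_⟩
    rintro rfl
    exact (mem_maximals.1 hb).2 x hx.1 (lt_of_le_of_ne hyx (Ne.symm hx.2))

open Classical in
theorem maximals_insert {ν : YoungDiagram} {a : ℕ × ℕ} (ha : a ∈ ν.addable) :
    maximals (insert a ν.cells) = insert a {b ∈ maximals ν.cells | ¬ b < a} := by
  obtain ⟨h1, h2⟩ := mem_addable.1 ha
  have h3 : ∀ x ∈ ν, ¬ a < x := fun x hx h => h1 (ν.isLowerSet h.le hx)
  ext b
  simp only [mem_maximals, mem_insert, mem_filter, mem_cells, forall_eq_or_imp]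
  constructor
  · rintro ⟨rfl | hb, h⟩
    · exact Or.inl rfl
    · exact Or.inr ⟨⟨hb, h.2⟩, h.1⟩
  · rintro (rfl | ⟨⟨hb, h⟩, h'⟩)
    · exact ⟨Or.inl rfl, lt_irrefl _, h3⟩
    · exact ⟨Or.inr hb, h', h⟩

open Classical in
theorem addable_eraseCell {ν : YoungDiagram} {b : ℕ × ℕ} (hb : b ∈ maximals ν.cells) :
    (ν.eraseCell b hb).addable = insert b {a ∈ ν.addable | ¬ b < a} := by
  obtain ⟨h1, h2⟩ := mem_maximals.1 hb
  have hmem : ∀ x, x ∈ ν.eraseCell b hb ↔ x ≠ b ∧ x ∈ ν := fun x => by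
    rw [← mem_cells, eraseCell, mem_erase, mem_cells]
  ext a
  simp only [mem_addable, mem_insert, mem_filter, hmem]
  constructor
  · rintro ⟨h3, h4⟩
    by_cases hab : a = b
    · exact Or.inl hab
    · exact Or.inr ⟨⟨fun h => h3 ⟨hab, h⟩, fun x hx => (h4 x hx).2⟩, fun h => (h4 b h).1 rfl⟩
  · rintro (rfl | ⟨⟨h3, h4⟩, h5⟩)
    · exact ⟨by simp, fun x hx => ⟨hx.ne, ν.isLowerSet hx.le h1⟩⟩
    · exact ⟨fun h => h3 h.2, fun x hx => ⟨by rintro rfl; exact h5 hx, h4 x hx⟩⟩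

theorem mk_mem_addable_iff {ν : YoungDiagram} {i j : ℕ} :
    (i, j) ∈ ν.addable ↔ j = ν.rowLen i ∧ (i = 0 ∨ ν.rowLen i < ν.rowLen (i - 1)) := by
  rw [mem_addable, mem_iff_lt_rowLen]
  constructor
  · rintro ⟨h1, h2⟩
    have hj : j = ν.rowLen i := by
      by_contra hne
      have : (i, j - 1) ∈ ν := h2 _ (Prod.mk_lt_mk.2 (Or.inr ⟨le_rfl, by omega⟩))
      rw [mem_iff_lt_rowLen] at this
      omega
    refine ⟨hj, or_iff_not_imp_left.2 fun hi => ?_⟩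
    have : (i - 1, j) ∈ ν := h2 _ (Prod.mk_lt_mk.2 (Or.inl ⟨by omega, le_rfl⟩))
    rwa [mem_iff_lt_rowLen, hj] at this
  · rintro ⟨rfl, h⟩
    refine ⟨lt_irrefl _, ?_⟩
    rintro ⟨k, l⟩ hkl
    rw [mem_iff_lt_rowLen]
    rcases Prod.mk_lt_mk.1 hkl with ⟨h1, h2⟩ | ⟨h1, h2⟩
    · have := ν.rowLen_anti k (i - 1) (by omega)
      omega
    · have := ν.rowLen_anti k i h1
      omega

theorem mk_mem_maximals_iff {ν : YoungDiagram} {i j : ℕ} :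
    (i, j) ∈ maximals ν.cells ↔ j + 1 = ν.rowLen i ∧ ν.rowLen (i + 1) < ν.rowLen i := by
  simp only [mem_maximals, mem_cells, mem_iff_lt_rowLen]
  constructor
  · rintro ⟨h1, h2⟩
    have h3 : (i, j + 1) ∉ ν := fun h => h2 _ h (Prod.mk_lt_mk.2 (Or.inr ⟨le_rfl, by omega⟩))
    have h4 : (i + 1, j) ∉ ν := fun h => h2 _ h (Prod.mk_lt_mk.2 (Or.inl ⟨by omega, le_rfl⟩))
    rw [mem_iff_lt_rowLen] at h3 h4
    omega
  · rintro ⟨h1, h2⟩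
    refine ⟨by omega, ?_⟩
    rintro ⟨k, l⟩ hkl hlt
    rw [mem_iff_lt_rowLen] at hkl
    rcases Prod.mk_lt_mk.1 hlt with ⟨h3, h4⟩ | ⟨h3, h4⟩
    · have := ν.rowLen_anti (i + 1) k h3
      omega
    · have := ν.rowLen_anti i k h3
      omega

theorem sum_addable_eq (ν : YoungDiagram) (w : ℕ × ℕ → ℤ) :
    ∑ a ∈ ν.addable, w a = w (0, ν.rowLen 0) + ∑ i ∈ range (ν.colLen 0),
      if ν.rowLen (i + 1) < ν.rowLen i then w (i + 1, ν.rowLen (i + 1)) else 0 := by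
  have h : ν.addable = ({i ∈ range (ν.colLen 0 + 1) |
      i = 0 ∨ ν.rowLen i < ν.rowLen (i - 1)}).image fun i => (i, ν.rowLen i) := by
    ext ⟨i, j⟩
    rw [mk_mem_addable_iff]
    simp only [mem_image, mem_filter, mem_range, Prod.mk.injEq]
    constructor
    · rintro ⟨rfl, hi⟩
      refine ⟨i, ⟨?_, hi⟩, rfl, rfl⟩
      rcases hi with rfl | hi
      · omega
      · have : (i - 1, 0) ∈ ν := mem_iff_lt_rowLen.2 (by omega)
        rw [mem_iff_lt_colLen] at this
        omega
    · rintro ⟨k, ⟨-, hk⟩, rfl, rfl⟩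
      exact ⟨rfl, hk⟩
  rw [h, sum_image (fun x _ y _ hxy => (Prod.mk.inj hxy).1), sum_filter, sum_range_succ', add_comm]
  simp

theorem sum_maximals_eq (ν : YoungDiagram) (w : ℕ × ℕ → ℤ) :
    ∑ b ∈ maximals ν.cells, w b = ∑ i ∈ range (ν.colLen 0),
      if ν.rowLen (i + 1) < ν.rowLen i then w (i, ν.rowLen i - 1) else 0 := by
  have h : maximals ν.cells = ({i ∈ range (ν.colLen 0) |
      ν.rowLen (i + 1) < ν.rowLen i}).image fun i => (i, ν.rowLen i - 1) := by
    ext ⟨i, j⟩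
    rw [mk_mem_maximals_iff]
    simp only [mem_image, mem_filter, mem_range, Prod.mk.injEq]
    constructor
    · rintro ⟨hj, hi⟩
      exact ⟨i, ⟨mem_iff_lt_colLen.1 (mem_iff_lt_rowLen.2 (by omega)), hi⟩, rfl, by omega⟩
    · rintro ⟨k, ⟨-, hk⟩, rfl, rfl⟩
      exact ⟨by omega, hk⟩
  rw [h, sum_image (fun x _ y _ hxy => (Prod.mk.inj hxy).1), sum_filter]

theorem sum_addable_sub_sum_maximals (ν : YoungDiagram) :
    ∑ a ∈ ν.addable, (1 - 2 * ((a.2 : ℤ) - a.1)) -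
      ∑ b ∈ maximals ν.cells, (1 - 2 * ((b.2 : ℤ) - b.1)) = 1 := by
  rw [sum_addable_eq, sum_maximals_eq, add_sub_assoc, ← sum_sub_distrib]
  have hterm : ∀ i ∈ range (ν.colLen 0),
      ((if ν.rowLen (i + 1) < ν.rowLen i then
          (1 - 2 * ((ν.rowLen (i + 1) : ℤ) - (i + 1 : ℕ))) else 0) -
        if ν.rowLen (i + 1) < ν.rowLen i then
          (1 - 2 * (((ν.rowLen i - 1 : ℕ) : ℤ) - i)) else 0) =
      2 * (ν.rowLen i : ℤ) - 2 * (ν.rowLen (i + 1) : ℤ) := by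
    intro i _
    have := ν.rowLen_anti i (i + 1) (by omega)
    split_ifs <;> omega
  have hlast : ν.rowLen (ν.colLen 0) = 0 := by
    by_contra h
    have : (ν.colLen 0, 0) ∈ ν := mem_iff_lt_rowLen.2 (by omega)
    rw [mem_iff_lt_colLen] at this
    omega
  rw [sum_congr rfl hterm, sum_range_sub' fun i => 2 * (ν.rowLen i : ℤ), hlast]
  push_cast
  ring

theorem sum_addable_card_linearExtensions (ν : YoungDiagram) :
    ∑ a ∈ ν.addable, (1 - 2 * ((a.2 : ℤ) - a.1)) *
      (Nat.card (linearExtensions (insert a ν.cells)) : ℤ) =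
      (ν.card + 1) * (Nat.card (linearExtensions ν.cells) : ℤ) := by
  classical
  induction hm : ν.card using Nat.strong_induction_on generalizing ν with
  | _ m ih =>
  subst hm
  set w : ℕ × ℕ → ℤ := fun a => 1 - 2 * ((a.2 : ℤ) - a.1)
  set F : Finset (ℕ × ℕ) → ℤ := fun s => (Nat.card (linearExtensions s) : ℤ) with hF
  have hrec : ∀ s : Finset (ℕ × ℕ), s.Nonempty → F s = ∑ b ∈ maximals s, F (s.erase b) :=
    fun s hs => by simp only [hF, card_linearExtensions hs, Nat.cast_sum]
  have hins : ∀ a ∈ ν.addable, w a * F (insert a ν.cells) = w a * F ν.cells +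
      ∑ b ∈ maximals ν.cells, if ¬ b < a then w a * F (insert a (ν.cells.erase b)) else 0 := by
    intro a ha
    have haν : a ∉ ν.cells := fun h => (mem_addable.1 ha).1 h
    rw [hrec _ (insert_nonempty _ _), maximals_insert ha, sum_insert, erase_insert haν, mul_add,
      mul_sum, sum_filter]
    · congr 1
      refine sum_congr rfl fun b hb => ?_
      have hab : a ≠ b := by rintro rfl; exact haν (mem_maximals.1 hb).1
      rw [erase_insert_of_ne hab]
    · exact fun h => haν (mem_maximals.1 (mem_filter.1 h).1).1
  have hers : ∀ b ∈ maximals ν.cells,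
      (∑ a ∈ ν.addable, if ¬ b < a then w a * F (insert a (ν.cells.erase b)) else 0) =
        ν.card * F (ν.cells.erase b) - w b * F ν.cells := by
    intro b hb
    have hbν := (mem_maximals.1 hb).1
    have hcard : (ν.eraseCell b hb).card + 1 = ν.card := card_erase_add_one hbν
    have h := ih _ (by omega) (ν.eraseCell b hb) rfl
    rw [addable_eraseCell hb, sum_insert fun h => (mem_addable.1 (mem_filter.1 h).1).1 hbν,
      sum_filter] at h
    have hcells : (ν.eraseCell b hb).cells = ν.cells.erase b := rfl
    rw [hcells, insert_erase hbν] at h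
    have hcast : (ν.card : ℤ) = (ν.eraseCell b hb).card + 1 := by exact_mod_cast hcard.symm
    rw [hcast, eq_sub_iff_add_eq, add_comm]
    exact h
  have htotal : ∑ b ∈ maximals ν.cells, (ν.card : ℤ) * F (ν.cells.erase b) =
      ν.card * F ν.cells := by
    rcases ν.cells.eq_empty_or_nonempty with h | h
    · simp [YoungDiagram.card, h]
    · rw [← mul_sum, ← hrec _ h]
  change ∑ a ∈ ν.addable, w a * F (insert a ν.cells) = (ν.card + 1) * F ν.cells
  rw [sum_congr rfl hins, sum_add_distrib, sum_comm, sum_congr rfl hers, sum_sub_distrib, htotal,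
    ← sum_mul, ← sum_mul]
  linear_combination F ν.cells * sum_addable_sub_sum_maximals ν

theorem exists_insertCell_eq {ν μ : YoungDiagram} (h : ν ≤ μ) (hcard : μ.card = ν.card + 1) :
    ∃ (a : ℕ × ℕ) (ha : a ∈ ν.addable), ν.insertCell a ha = μ := by
  have hsub : ν.cells ⊆ μ.cells := h
  obtain ⟨a, ha⟩ : ∃ a, μ.cells \ ν.cells = {a} := by
    rw [← card_eq_one, card_sdiff_of_subset hsub]
    change μ.card - ν.card = 1
    omega
  have haμ : a ∈ μ.cells \ ν.cells := by simp [ha]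
  obtain ⟨h1, h2⟩ := mem_sdiff.1 haμ
  have hadd : a ∈ ν.addable := by
    refine mem_addable.2 ⟨h2, fun x hx => ?_⟩
    by_contra hxν
    have : x ∈ μ.cells \ ν.cells := mem_sdiff.2 ⟨μ.isLowerSet hx.le h1, hxν⟩
    rw [ha, mem_singleton] at this
    exact hx.ne this
  refine ⟨a, hadd, YoungDiagram.ext ?_⟩
  change insert a ν.cells = μ.cells
  rw [← sdiff_union_of_subset hsub, ha, insert_eq]

/-- A sum over the diagrams covering `ν` is a sum over the addable cells of `ν`. -/
theorem finsum_card_eq_succ (ν : YoungDiagram) (g : Finset (ℕ × ℕ) → ℤ) :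
    ∑ᶠ (μ : YoungDiagram) (_ : ν ≤ μ ∧ μ.card = ν.card + 1), g μ.cells =
      ∑ a ∈ ν.addable, g (insert a ν.cells) := by
  classical
  rw [← finsum_mem_coe_finset]
  let e : ℕ × ℕ → YoungDiagram := fun a => if ha : a ∈ ν.addable then ν.insertCell a ha else ν
  have he : ∀ a ∈ ν.addable, (e a).cells = insert a ν.cells := fun a ha => by
    simp [e, ha, insertCell]
  have hmem : ∀ a ∈ ν.addable, a ∉ ν.cells := fun a ha => (mem_addable.1 ha).1
  refine (finsum_mem_eq_of_bijOn (t := {μ : YoungDiagram | ν ≤ μ ∧ μ.card = ν.card + 1}) e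
    ⟨fun a ha => ?_, fun a ha b hb hab => ?_, fun μ hμ => ?_⟩
    fun a ha => by rw [he a ha]).symm
  · refine ⟨?_, ?_⟩
    · rw [← cells_subset_iff, he a ha]
      exact subset_insert _ _
    · rw [YoungDiagram.card, he a ha, card_insert_of_notMem (hmem a ha)]
  · have h : a ∈ insert b ν.cells := by
      rw [← he b hb, ← hab, he a ha]
      exact mem_insert_self _ _
    exact (mem_insert.1 h).resolve_right (hmem a ha)
  · obtain ⟨a, ha, rfl⟩ := exists_insertCell_eq hμ.1 hμ.2
    exact ⟨a, ha, by simp [e, ha]⟩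

end YoungDiagram

/-- for a partition `ν` of `n - 1`,
`n · f_ν = Σ_μ f_μ (1 - 2 c(μ/ν))`, the sum running over all Young diagrams `μ` of
size `n` containing `ν`; the content `c(μ/ν)` of the unique added box `(i, j)` is
`j - i`, expressed here as a sum over the single cell of `μ.cells \ ν.cells`. -/
theorem stmt_15 (n : ℕ) (hn : 1 ≤ n) (ν : YoungDiagram) (hν : ν.card = n - 1) :
    (n : ℤ) * sytCount ν =
      ∑ᶠ (μ : YoungDiagram) (_ : ν ≤ μ ∧ μ.card = n),
        (sytCount μ : ℤ) *
          (1 - 2 * ∑ c ∈ μ.cells \ ν.cells, ((c.2 : ℤ) - (c.1 : ℤ))) := by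
  obtain rfl : n = ν.card + 1 := by omega
  simp only [sytCount_eq_card_linearExtensions]
  rw [ν.finsum_card_eq_succ fun s => (Nat.card (linearExtensions s) : ℤ) *
    (1 - 2 * ∑ c ∈ s \ ν.cells, ((c.2 : ℤ) - (c.1 : ℤ)))]
  push_cast
  rw [← ν.sum_addable_card_linearExtensions]
  refine sum_congr rfl fun a ha => ?_
  rw [insert_sdiff_of_notMem _ (YoungDiagram.mem_addable.1 ha).1, Finset.sdiff_self, insert_empty_eq,
    sum_singleton, mul_comm]
end

section
/- Let n ≥ 2 and let λ = (λ_1 ≥ … ≥ λ_{n−1} > 0) be a partition of n(n−1) with exactly n−1 nonzero parts and λ_{n−1} ≥ n−1. Let μ = (λ_1+1, λ_2+1, …, λ_{n−1}+1, n, 1), a partition of n(n+1) with n+1 parts. Then ⟨a_{δ_{n+1}}^2, s_μ⟩ = (−1)^n · 3n · ⟨a_{δ_n}^2, s_λ⟩. -/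
open MvPolynomial Finset

/-- The Vandermonde determinant `a_{δ_n} = ∏_{1 ≤ i < j ≤ n} (x_i - x_j)`
as a multivariate polynomial over `ℤ` in variables indexed by `Fin n`. -/
noncomputable def vandermondePoly (n : ℕ) : MvPolynomial (Fin n) ℤ :=
  ∏ p ∈ Finset.univ.filter (fun p : Fin n × Fin n => p.1 < p.2), (X p.1 - X p.2)

/-- `⟨a_{δ_n}^{2k}, s_λ⟩`: the coefficient of the Schur function `s_λ` in the expansion
of `a_{δ_n}^{2k}`, i.e. the coefficient of the monomial
`x^{λ+δ_n} = x_1^{λ_1+n-1} x_2^{λ_2+n-2} ⋯ x_n^{λ_n}` in `a_{δ_n}^{2k+1}`.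
Here `lam i` is the part `λ_{i+1}` (0-indexed) and `δ_n` has `i`-th entry `n - 1 - i`. -/
noncomputable def schurCoeff (n k : ℕ) (lam : Fin n → ℕ) : ℤ :=
  MvPolynomial.coeff
    (Finsupp.equivFunOnFinite.symm fun i : Fin n => lam i + (n - 1 - (i : ℕ)))
    (vandermondePoly n ^ (2 * k + 1))

/-- The product of the pairwise differences `v i - v j` over `i < j`. -/
def pairDiffProd {A : Type*} [CommRing A] {n : ℕ} (v : Fin n → A) : A :=
  ∏ i, ∏ j ∈ Ioi i, (v i - v j)

theorem vandermondePoly_eq_pairDiffProd (n : ℕ) :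
    vandermondePoly n = pairDiffProd (X : Fin n → MvPolynomial (Fin n) ℤ) := by
  rw [vandermondePoly, pairDiffProd, Finset.prod_filter, ← Finset.univ_product_univ,
    Finset.prod_product]
  refine Finset.prod_congr rfl fun i _ => ?_
  rw [← Finset.prod_filter]
  congr 1
  ext j
  simp

theorem pairDiffProd_succ {A : Type*} [CommRing A] {n : ℕ} (v : Fin (n + 1) → A) :
    pairDiffProd v = (∏ j, (v 0 - v (Fin.succ j))) * pairDiffProd (fun j => v (Fin.succ j)) := by
  simp only [pairDiffProd, Fin.prod_univ_succ, Fin.prod_Ioi_zero, Fin.prod_Ioi_succ]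

theorem map_pairDiffProd {A B F : Type*} [CommRing A] [CommRing B] [FunLike F A B]
    [RingHomClass F A B] (f : F) {n : ℕ}
    (v : Fin n → A) : f (pairDiffProd v) = pairDiffProd (fun i => f (v i)) := by
  simp [pairDiffProd, map_prod]

/-- The monic polynomial `∏ i, (X - x_i)` over the ring of polynomials in the `x_i`. -/
noncomputable def rootProd (n : ℕ) : Polynomial (MvPolynomial (Fin n) ℤ) :=
  ∏ i, (Polynomial.X - Polynomial.C (X i))

theorem finSuccEquiv_vandermondePoly (n : ℕ) :
    finSuccEquiv ℤ n (vandermondePoly (n + 1)) =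
      rootProd n * Polynomial.C (vandermondePoly n) := by
  have h := map_pairDiffProd (finSuccEquiv ℤ n) (X : Fin (n + 1) → MvPolynomial _ ℤ)
  rw [← vandermondePoly_eq_pairDiffProd, pairDiffProd_succ] at h
  simp only [finSuccEquiv_X_zero, finSuccEquiv_X_succ] at h
  rw [h, rootProd, vandermondePoly_eq_pairDiffProd n, map_pairDiffProd]

theorem coeff_mapDomainRingHom {σ G : Type*} [AddMonoid G] (φ : (σ →₀ ℕ) →+ G)
    (hφ : Function.Injective φ) (p : MvPolynomial σ ℤ) (a : σ →₀ ℕ) :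
    (AddMonoidAlgebra.mapDomainRingHom ℤ φ p).coeff (φ a) = coeff a p :=
  Finsupp.mapDomain_apply hφ _ _

/-- Exponent vectors as integer vectors. -/
def intExponents (n : ℕ) : (Fin n →₀ ℕ) →+ (Fin n → ℤ) where
  toFun a i := a i
  map_zero' := by ext; simp
  map_add' a b := by ext; simp

/-- Exponent vectors as integer vectors, negated and with the order of the variables reversed. -/
def revExponents (n : ℕ) : (Fin n →₀ ℕ) →+ (Fin n → ℤ) where
  toFun a i := -(a (Fin.rev i) : ℤ)
  map_zero' := by ext; simp
  map_add' a b := by ext; simp; ring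

theorem intExponents_injective (n : ℕ) : Function.Injective (intExponents n) := by
  intro a b h
  ext i
  have := congrFun h i
  simpa [intExponents] using this

theorem revExponents_injective (n : ℕ) : Function.Injective (revExponents n) := by
  intro a b h
  ext i
  have := congrFun h (Fin.rev i)
  simpa [revExponents] using this

theorem intExponents_single {n : ℕ} (i : Fin n) :
    intExponents n (Finsupp.single i 1) = Pi.single i 1 := by
  ext j
  simp [intExponents, Finsupp.single_apply, Pi.single_apply, eq_comm]

theorem revExponents_single {n : ℕ} (i : Fin n) :
    revExponents n (Finsupp.single (Fin.rev i) 1) = -Pi.single i 1 := by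
  ext j
  simp [revExponents, Finsupp.single_apply, Pi.single_apply, eq_comm]

theorem sum_single_add_single (n : ℕ) :
    ∑ p ∈ Finset.univ.filter (fun p : Fin n × Fin n => p.1 < p.2),
      (Pi.single p.1 1 + Pi.single p.2 1 : Fin n → ℤ) = fun _ => (n : ℤ) - 1 := by
  ext k
  simp only [Finset.sum_apply, Pi.add_apply, Finset.sum_add_distrib, Pi.single_apply]
  have h1 : ∑ p ∈ Finset.univ.filter (fun p : Fin n × Fin n => p.1 < p.2),
      (if k = p.1 then (1 : ℤ) else 0) = #(Ioi k) := by
    rw [Finset.sum_filter, ← Finset.univ_product_univ, Finset.sum_product]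
    rw [Finset.sum_eq_single k (fun b _ hb => by simp [hb.symm]) (by simp)]
    simp [Finset.filter_lt_eq_Ioi]
  have h2 : ∑ p ∈ Finset.univ.filter (fun p : Fin n × Fin n => p.1 < p.2),
      (if k = p.2 then (1 : ℤ) else 0) = #(Iio k) := by
    rw [Finset.sum_filter, ← Finset.univ_product_univ, Finset.sum_product_right]
    rw [Finset.sum_eq_single k (fun b _ hb => by simp [hb.symm]) (by simp)]
    simp [Finset.filter_gt_eq_Iio]
  rw [h1, h2, Fin.card_Ioi, Fin.card_Iio]
  have := k.2
  omega

theorem mapDomainRingHom_revExponents_vandermondePoly (n : ℕ) :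
    AddMonoidAlgebra.mapDomainRingHom ℤ (revExponents n) (vandermondePoly n) =
      AddMonoidAlgebra.mapDomainRingHom ℤ (intExponents n) (vandermondePoly n) *
        AddMonoidAlgebra.single (-fun _ => (n : ℤ) - 1) 1 := by
  have hX (φ : (Fin n →₀ ℕ) →+ (Fin n → ℤ)) (i : Fin n) :
      AddMonoidAlgebra.mapDomainRingHom ℤ φ (X i) =
        AddMonoidAlgebra.single (φ (Finsupp.single i 1)) 1 :=
    AddMonoidAlgebra.mapDomain_single
  have hs : (AddMonoidAlgebra.single (-fun _ => (n : ℤ) - 1) 1 : AddMonoidAlgebra ℤ (Fin n → ℤ)) =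
      ∏ p ∈ Finset.univ.filter (fun p : Fin n × Fin n => p.1 < p.2),
        AddMonoidAlgebra.single (-(Pi.single p.1 1 + Pi.single p.2 1)) 1 := by
    rw [← sum_single_add_single, ← Finset.sum_neg_distrib]
    exact map_prod (AddMonoidAlgebra.of ℤ (Fin n → ℤ))
      (fun p : Fin n × Fin n => Multiplicative.ofAdd (-(Pi.single p.1 1 + Pi.single p.2 1))) _
  rw [hs, vandermondePoly, map_prod, map_prod, ← Finset.prod_mul_distrib]
  refine Finset.prod_bij' (fun p _ => (Fin.rev p.2, Fin.rev p.1))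
    (fun p _ => (Fin.rev p.2, Fin.rev p.1)) ?_ ?_ ?_ ?_ ?_
  · simp
  · simp
  · simp
  · simp
  rintro ⟨i, j⟩ -
  obtain ⟨i, rfl⟩ := Fin.rev_surjective i
  obtain ⟨j, rfl⟩ := Fin.rev_surjective j
  simp only [map_sub, hX, Fin.rev_rev, intExponents_single, revExponents_single, sub_mul,
    AddMonoidAlgebra.single_mul_single, mul_one]
  congr 2 <;> abel

theorem coeff_vandermondePoly_pow_rev (n k : ℕ) (a b : Fin n →₀ ℕ)
    (h : ∀ i, b i + a (Fin.rev i) = k * (n - 1)) :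
    coeff a (vandermondePoly n ^ k) = coeff b (vandermondePoly n ^ k) := by
  rw [← coeff_mapDomainRingHom _ (revExponents_injective n),
    ← coeff_mapDomainRingHom _ (intExponents_injective n), map_pow,
    mapDomainRingHom_revExponents_vandermondePoly, mul_pow, ← map_pow, AddMonoidAlgebra.single_pow,
    one_pow]
  have : revExponents n a = intExponents n b + k • (-fun _ => (n : ℤ) - 1) := by
    ext i
    have := h i
    have hn : 1 ≤ n := by have := i.2; omega
    zify [hn] at this
    simp [revExponents, intExponents]
    linarith
  rw [this, AddMonoidAlgebra.coeff_mul_single_apply]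
  simp

theorem prod_sq_mem_span {A T : Type*} [CommRing A] [CommRing T] [Algebra A T] (t : T) {m : ℕ}
    (v : Fin (m + 1) → A) (K : Fin (m + 1) → T)
    (hK : ∀ i, K i * (1 - t * algebraMap A T (v i)) = 1) :
    t ^ (2 * m + 1) * algebraMap A T (pairDiffProd v ^ 3) * ∏ i, K i ^ 2 ∈
      Submodule.span A (Set.range (fun i => t * K i ^ 2) ∪ Set.range K) := by
  induction m with
  | zero =>
    refine Submodule.subset_span (Or.inl ⟨0, ?_⟩)
    simp [pairDiffProd]
  | succ m ih =>
    have ih := ih (fun j => v j.succ) (fun j => K j.succ) (fun j => hK _)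
    set M := Submodule.span A (Set.range (fun i => t * K i ^ 2) ∪ Set.range K) with hM
    have hsq (i) : t * K i ^ 2 ∈ M := Submodule.subset_span (Or.inl ⟨i, rfl⟩)
    have hK1 (i) : K i ∈ M := Submodule.subset_span (Or.inr ⟨i, rfl⟩)
    have step : ∀ w ∈ Submodule.span A (Set.range (fun j : Fin (m + 1) => t * K j.succ ^ 2) ∪
        Set.range fun j : Fin (m + 1) => K j.succ),
        t ^ 2 * K 0 ^ 2 * algebraMap A T ((∏ j : Fin (m + 1), (v 0 - v j.succ)) ^ 3) * w ∈ M := by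
      intro w hw
      induction hw using Submodule.span_induction with
      | zero => simp
      | add x y _ _ hx hy => rw [mul_add]; exact M.add_mem hx hy
      | smul a x _ hx => rw [mul_smul_comm]; exact M.smul_mem a hx
      | mem x hx =>
        have key (j : Fin (m + 1)) :
            t * (algebraMap A T (v 0) - algebraMap A T (v j.succ)) * K 0 * K j.succ =
              K 0 - K j.succ := by
          linear_combination (-K j.succ) * hK 0 + K 0 * hK j.succ
        rcases hx with ⟨j, rfl⟩ | ⟨j, rfl⟩
        all_goals
          rw [← Finset.mul_prod_erase _ _ (Finset.mem_univ j)]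
          generalize (∏ i ∈ univ.erase j, (v 0 - v (Fin.succ i))) = P
          have kj := key j
          have k2 : _ ^ 2 = _ ^ 2 := congrArg (fun z => z ^ 2) kj
        · have : t ^ 2 * K 0 ^ 2 * algebraMap A T (((v 0 - v j.succ) * P) ^ 3) *
              (t * K j.succ ^ 2) =
              ((v 0 - v j.succ) * P ^ 3) • (t * K 0 ^ 2) +
              ((v 0 - v j.succ) * P ^ 3) • (t * K j.succ ^ 2) +
              (-2 * P ^ 3) • K 0 + (2 * P ^ 3) • K j.succ := by
            simp only [Algebra.smul_def, map_mul, map_sub, map_pow, map_neg, map_ofNat]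
            linear_combination algebraMap A T P ^ 3 *
              (t * (algebraMap A T (v 0) - algebraMap A T (v j.succ)) * k2 - 2 * kj)
          rw [this]
          exact M.add_mem (M.add_mem (M.add_mem (M.smul_mem _ (hsq _)) (M.smul_mem _ (hsq _)))
            (M.smul_mem _ (hK1 _))) (M.smul_mem _ (hK1 _))
        · have : t ^ 2 * K 0 ^ 2 * algebraMap A T (((v 0 - v j.succ) * P) ^ 3) * K j.succ =
              ((v 0 - v j.succ) ^ 2 * P ^ 3) • (t * K 0 ^ 2) +
              (-(v 0 - v j.succ) * P ^ 3) • K 0 + ((v 0 - v j.succ) * P ^ 3) • K j.succ := by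
            simp only [Algebra.smul_def, map_mul, map_sub, map_pow, map_neg]
            linear_combination algebraMap A T P ^ 3 *
              (algebraMap A T (v 0) - algebraMap A T (v j.succ)) *
              (t * (algebraMap A T (v 0) - algebraMap A T (v j.succ)) * K 0 * kj - kj)
          rw [this]
          exact M.add_mem (M.add_mem (M.smul_mem _ (hsq _))
            (M.smul_mem _ (hK1 _))) (M.smul_mem _ (hK1 _))
    have := step _ ih
    rw [pairDiffProd_succ, Fin.prod_univ_succ (fun i => K i ^ 2)]
    convert this using 1
    rw [mul_pow, map_mul]
    ring

/-- The geometric series `1 / (1 - x_i t)`. -/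
noncomputable def geomSeries {n : ℕ} (i : Fin n) : PowerSeries (MvPolynomial (Fin n) ℤ) :=
  PowerSeries.mk fun k => X i ^ k

theorem geomSeries_mul {n : ℕ} (i : Fin n) :
    geomSeries i * (1 - PowerSeries.X * PowerSeries.C (X i)) = 1 := by
  ext1 k
  rw [mul_sub, mul_one, ← mul_assoc, map_sub, PowerSeries.coeff_mul_C]
  cases k with
  | zero => simp [geomSeries]
  | succ k =>
    rw [PowerSeries.coeff_succ_mul_X]
    simp [geomSeries, pow_succ, PowerSeries.coeff_one]

theorem coeff_geomSeries_sq {n : ℕ} (i : Fin n) (k : ℕ) :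
    PowerSeries.coeff k (geomSeries i ^ 2) = ((k : MvPolynomial (Fin n) ℤ) + 1) * X i ^ k := by
  rw [sq, PowerSeries.coeff_mul]
  simp only [geomSeries, PowerSeries.coeff_mk, ← pow_add]
  rw [Finset.sum_congr rfl (fun p hp => by rw [Finset.HasAntidiagonal.mem_antidiagonal.1 hp])]
  simp

/-- The ideal of polynomials all of whose monomials have some exponent larger than `2 * n`. -/
noncomputable def highExponentIdeal (n : ℕ) : Ideal (MvPolynomial (Fin n) ℤ) :=
  Ideal.span (Set.range fun i => X i ^ (2 * n + 1))

theorem X_pow_mem_highExponentIdeal {n k : ℕ} (i : Fin n) (hk : 2 * n + 1 ≤ k) :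
    (X i ^ k : MvPolynomial (Fin n) ℤ) ∈ highExponentIdeal n :=
  Ideal.pow_mem_of_pow_mem _ (Ideal.subset_span ⟨i, rfl⟩) hk

theorem coeff_eq_zero_of_mem_highExponentIdeal {n : ℕ} {p : MvPolynomial (Fin n) ℤ}
    (hp : p ∈ highExponentIdeal n) {a : Fin n →₀ ℕ} (ha : ∀ i, a i ≤ 2 * n) : coeff a p = 0 := by
  rw [highExponentIdeal] at hp
  induction hp using Submodule.span_induction generalizing a with
  | zero => simp
  | add x y _ _ hx hy => rw [coeff_add, hx ha, hy ha, add_zero]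
  | smul q x _ hx =>
    rw [smul_eq_mul, coeff_mul]
    refine Finset.sum_eq_zero fun b hb => ?_
    rw [hx, mul_zero]
    intro i
    have := congrArg (fun f : Fin n →₀ ℕ => f i) (Finset.HasAntidiagonal.mem_antidiagonal.1 hb)
    have h2 := ha i
    simp only [Finsupp.add_apply] at this
    omega
  | mem x hx =>
    obtain ⟨i, rfl⟩ := hx
    simp only
    rw [X_pow_eq_monomial, coeff_monomial, if_neg]
    rintro rfl
    have := ha i
    simp at this

theorem vandermondePoly_cube_mul_coeff_mem {m r : ℕ} (hr : 3 ≤ r) :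
    vandermondePoly (m + 1) ^ 3 *
      PowerSeries.coeff r (∏ i : Fin (m + 1), geomSeries i ^ 2) ∈ highExponentIdeal (m + 1) := by
  have h := prod_sq_mem_span (A := MvPolynomial (Fin (m + 1)) ℤ) PowerSeries.X X geomSeries
    geomSeries_mul
  have key : ∀ w ∈ Submodule.span (MvPolynomial (Fin (m + 1)) ℤ)
      (Set.range (fun i : Fin (m + 1) => PowerSeries.X * geomSeries i ^ 2) ∪
        Set.range geomSeries),
      PowerSeries.coeff (r + (2 * m + 1)) w ∈ highExponentIdeal (m + 1) := by
    intro w hw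
    induction hw using Submodule.span_induction with
    | zero => simp
    | add x y _ _ hx hy => rw [map_add]; exact Ideal.add_mem _ hx hy
    | smul a x _ hx => rw [PowerSeries.coeff_smul]; exact Ideal.mul_mem_left _ _ hx
    | mem x hx =>
      rcases hx with ⟨j, rfl⟩ | ⟨j, rfl⟩
      · simp only
        rw [← add_assoc, PowerSeries.coeff_succ_X_mul, coeff_geomSeries_sq]
        exact Ideal.mul_mem_left _ _ (X_pow_mem_highExponentIdeal _ (by omega))
      · rw [geomSeries, PowerSeries.coeff_mk]
        exact X_pow_mem_highExponentIdeal _ (by omega)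
  have := key _ h
  rwa [mul_assoc, PowerSeries.coeff_X_pow_mul, PowerSeries.algebraMap_apply, Algebra.algebraMap_self,
    RingHom.id_apply, PowerSeries.coeff_C_mul, ← vandermondePoly_eq_pairDiffProd] at this

/-- The power series `∏ i, (1 - x_i t)`. -/
noncomputable def linProd (n : ℕ) : PowerSeries (MvPolynomial (Fin n) ℤ) :=
  ∏ i, (1 - PowerSeries.X * PowerSeries.C (X i))

theorem linProd_sq_mul (n : ℕ) : linProd n ^ 2 * ∏ i : Fin n, geomSeries i ^ 2 = 1 := by
  rw [linProd, ← Finset.prod_pow, ← Finset.prod_mul_distrib]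
  refine Finset.prod_eq_one fun i _ => ?_
  rw [← mul_pow, mul_comm, geomSeries_mul, one_pow]

theorem two_mul_linProd_add (n : ℕ) :
    2 * (linProd n + PowerSeries.X * PowerSeries.derivative _ (linProd n)) =
      linProd n ^ 3 * (2 * ∏ i : Fin n, geomSeries i ^ 2 -
        PowerSeries.X * PowerSeries.derivative _ (∏ i : Fin n, geomSeries i ^ 2)) := by
  have h := linProd_sq_mul n
  generalize (∏ i : Fin n, geomSeries i ^ 2) = W at *
  have h' := congrArg (PowerSeries.derivative _) h
  rw [Derivation.leibniz, Derivation.leibniz_pow, Derivation.map_one_eq_zero] at h'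
  simp only [smul_eq_mul, nsmul_eq_mul] at h'
  push_cast at h'
  linear_combination (-2 * linProd n - 2 * PowerSeries.X * PowerSeries.derivative _ (linProd n)) * h
    + PowerSeries.X * linProd n * h'

theorem constantCoeff_coeff_one_prod_geomSeries_sq {n : ℕ} (s : Finset (Fin n)) :
    PowerSeries.coeff 0 (∏ i ∈ s, geomSeries i ^ 2) = 1 ∧
      PowerSeries.coeff 1 (∏ i ∈ s, geomSeries i ^ 2) = 2 * ∑ i ∈ s, X i := by
  induction s using Finset.induction_on with
  | empty => simp [PowerSeries.coeff_one]
  | insert a s ha ih =>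
    rw [Finset.prod_insert ha, Finset.sum_insert ha, PowerSeries.coeff_mul, PowerSeries.coeff_mul,
      Finset.Nat.antidiagonal_zero, Finset.Nat.antidiagonal_succ]
    simp only [Finset.Nat.antidiagonal_zero, Finset.sum_singleton, Finset.sum_cons,
      Finset.map_singleton, Function.Embedding.prodMap, Function.Embedding.coeFn_mk, Prod.map_apply,
      Function.Embedding.refl_apply, Nat.succ_eq_add_one, zero_add, coeff_geomSeries_sq, ih.1, ih.2]
    refine ⟨by simp, ?_⟩
    push_cast
    ring

theorem vandermondePoly_cube_mul_linProd_coeff_mem (m k : ℕ) :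
    vandermondePoly (m + 1) ^ 3 *
      (2 * ((k + 1) * PowerSeries.coeff k (linProd (m + 1))) -
        2 * PowerSeries.coeff k (linProd (m + 1) ^ 3 *
          (1 + PowerSeries.X * PowerSeries.C (∑ i, X i)))) ∈ highExponentIdeal (m + 1) := by
  have h1 : PowerSeries.coeff k (2 * (linProd (m + 1) +
      PowerSeries.X * PowerSeries.derivative _ (linProd (m + 1)))) =
      2 * ((k + 1) * PowerSeries.coeff k (linProd (m + 1))) := by
    rw [two_mul, map_add, map_add, ← two_mul]
    congr 1
    cases k with
    | zero => simp
    | succ k =>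
      rw [PowerSeries.coeff_succ_X_mul, PowerSeries.coeff_derivative]
      push_cast
      ring
  have h2 : 2 * PowerSeries.coeff k (linProd (m + 1) ^ 3 *
      (1 + PowerSeries.X * PowerSeries.C (∑ i, X i))) =
      PowerSeries.coeff k (linProd (m + 1) ^ 3 *
      (2 * (1 + PowerSeries.X * PowerSeries.C (∑ i, X i)))) := by
    rw [mul_left_comm, two_mul, two_mul, map_add]
  rw [h2, ← h1, two_mul_linProd_add, ← map_sub, ← mul_sub, PowerSeries.coeff_mul, Finset.mul_sum]
  refine Ideal.sum_mem _ fun p _ => ?_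
  rw [mul_left_comm]
  refine Ideal.mul_mem_left _ _ ?_
  obtain ⟨hc0, hc1⟩ := constantCoeff_coeff_one_prod_geomSeries_sq (univ : Finset (Fin (m + 1)))
  have hmem (r : ℕ) (hr : 3 ≤ r) := vandermondePoly_cube_mul_coeff_mem (m := m) hr
  generalize (∏ i : Fin (m + 1), geomSeries i ^ 2) = W at *
  generalize (∑ i : Fin (m + 1), (X i : MvPolynomial _ ℤ)) = s at *
  obtain ⟨-, r⟩ := p
  have hX (u : PowerSeries (MvPolynomial (Fin (m + 1)) ℤ)) (j : ℕ) :
      PowerSeries.coeff (j + 1) (PowerSeries.X * u) = PowerSeries.coeff j u :=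
    PowerSeries.coeff_succ_X_mul _ _
  have hsucc (j : ℕ) : PowerSeries.coeff (j + 1)
      (2 * W - PowerSeries.X * PowerSeries.derivative _ W -
        2 * (1 + PowerSeries.X * PowerSeries.C s)) =
      (1 - j) * PowerSeries.coeff (j + 1) W - 2 * PowerSeries.coeff j (PowerSeries.C s) := by
    rw [two_mul, two_mul]
    simp only [map_sub, map_add, hX, PowerSeries.coeff_derivative, PowerSeries.coeff_one,
      Nat.add_eq_zero_iff, one_ne_zero, and_false, if_false]
    ring
  simp only
  match r with
  | 0 =>
    convert (highExponentIdeal (m + 1)).zero_mem using 1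
    rw [two_mul, two_mul]
    simp only [map_sub, map_add, hc0]
    simp
  | 1 =>
    convert (highExponentIdeal (m + 1)).zero_mem using 1
    rw [hsucc 0, zero_add, hc1]
    simp
  | 2 =>
    convert (highExponentIdeal (m + 1)).zero_mem using 1
    rw [hsucc 1]
    simp
  | r + 3 =>
    convert Ideal.mul_mem_left _ (-((r : MvPolynomial (Fin (m + 1)) ℤ) + 1))
      (hmem (r + 3) (by omega)) using 1
    rw [hsucc (r + 2)]
    simp
    ring

theorem rootProd_monic (n : ℕ) : (rootProd n).Monic :=
  Polynomial.monic_prod_X_sub_C _ _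

theorem natDegree_rootProd (n : ℕ) : (rootProd n).natDegree = n := by
  rw [rootProd, Polynomial.natDegree_finsetProd_X_sub_C_eq_card, Finset.card_univ,
    Fintype.card_fin]

theorem coe_reverse_rootProd (n : ℕ) :
    ((rootProd n).reverse : PowerSeries (MvPolynomial (Fin n) ℤ)) = linProd n := by
  have h (s : Finset (Fin n)) :
      ((∏ i ∈ s, (Polynomial.X - Polynomial.C (X i : MvPolynomial (Fin n) ℤ))).reverse :
        PowerSeries (MvPolynomial (Fin n) ℤ)) =
      ∏ i ∈ s, (1 - PowerSeries.X * PowerSeries.C (X i)) := by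
    induction s using Finset.induction_on with
    | empty =>
      rw [Finset.prod_empty, Finset.prod_empty, ← Polynomial.C_1, Polynomial.reverse_C,
        Polynomial.C_1, Polynomial.coe_one]
    | insert a s ha ih =>
      rw [Finset.prod_insert ha, Finset.prod_insert ha, Polynomial.reverse_mul_of_domain,
        Polynomial.coe_mul, ih]
      congr 1
      rw [Polynomial.reverse, Polynomial.natDegree_X_sub_C, Polynomial.reflect_sub,
        Polynomial.reflect_C, pow_one, Polynomial.reflect_one_X, Polynomial.coe_sub,
        Polynomial.coe_mul, Polynomial.coe_one, Polynomial.coe_C, Polynomial.coe_X, mul_comm]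
  exact h univ

theorem coeff_rootProd_pow {n k j l : ℕ} (h : j + l = k * n) :
    (rootProd n ^ k).coeff j = PowerSeries.coeff l (linProd n ^ k) := by
  have hrev : (((rootProd n ^ k).reverse : Polynomial (MvPolynomial (Fin n) ℤ)) :
      PowerSeries (MvPolynomial (Fin n) ℤ)) = linProd n ^ k := by
    rw [← coe_reverse_rootProd, ← Polynomial.coe_pow]
    congr 1
    induction k generalizing j l with
    | zero => simp [← Polynomial.C_1, -map_one]
    | succ k ih =>
      rw [pow_succ, pow_succ, Polynomial.reverse_mul_of_domain, ih (j := k * n) (l := 0) rfl]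
  rw [← hrev, Polynomial.coeff_coe, Polynomial.coeff_reverse, (rootProd_monic n).natDegree_pow,
    natDegree_rootProd, Polynomial.revAt_le (by omega)]
  congr 1
  omega

theorem coeff_linProd_self (n : ℕ) :
    PowerSeries.coeff n (linProd n) = (-1) ^ n * ∏ i, X i := by
  have h := coeff_rootProd_pow (n := n) (k := 1) (j := 0) (l := n) (by omega)
  rw [pow_one, pow_one] at h
  rw [← h, rootProd, Polynomial.coeff_zero_prod]
  simp [Finset.prod_neg]

theorem coeff_rootProd_cube_top (n : ℕ) : (rootProd n ^ 3).coeff (3 * n) = 1 := by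
  have h := ((rootProd_monic n).pow 3).coeff_natDegree
  rwa [(rootProd_monic n).natDegree_pow, natDegree_rootProd] at h

theorem coeff_rootProd_cube_next (n : ℕ) :
    (rootProd (n + 1) ^ 3).coeff (3 * n + 2) = -3 * ∑ i, X i := by
  have h := (rootProd_monic (n + 1)).nextCoeff_pow 3
  rw [Polynomial.nextCoeff_of_natDegree_pos, (rootProd_monic _).natDegree_pow,
    natDegree_rootProd, rootProd, Polynomial.prod_X_sub_C_nextCoeff] at h
  · rw [rootProd, show 3 * n + 2 = 3 * (n + 1) - 1 by omega, h]
    simp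
  · rw [(rootProd_monic _).natDegree_pow, natDegree_rootProd]
    omega

theorem coeff_cons_mul_vandermondePoly_cube {n : ℕ} (q : MvPolynomial (Fin (n + 1)) ℤ) (b : ℕ)
    (c : Fin n →₀ ℕ) :
    coeff (c.cons b) (q * vandermondePoly (n + 1) ^ 3) =
      coeff c ((finSuccEquiv ℤ n q * rootProd n ^ 3).coeff b * vandermondePoly n ^ 3) := by
  rw [← finSuccEquiv_coeff_coeff, map_mul, map_pow, finSuccEquiv_vandermondePoly, mul_pow,
    ← Polynomial.C_pow, ← mul_assoc, Polynomial.coeff_mul_C]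

theorem coeff_cons_vandermondePoly_cube {n : ℕ} (b : ℕ) (c : Fin n →₀ ℕ) :
    coeff (c.cons b) (vandermondePoly (n + 1) ^ 3) =
      coeff c ((rootProd n ^ 3).coeff b * vandermondePoly n ^ 3) := by
  simpa using coeff_cons_mul_vandermondePoly_cube 1 b c

theorem coeff_vandermondePoly_cube_mul_linProd {m : ℕ} {c : Fin (m + 1) →₀ ℕ}
    (hc : ∀ i, c i ≤ 2 * (m + 1)) :
    coeff c (vandermondePoly (m + 1) ^ 3 * (PowerSeries.coeff (m + 1) (linProd (m + 1) ^ 3 *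
      (1 + PowerSeries.X * PowerSeries.C (∑ i, X i))))) =
    ((m : ℤ) + 2) * (-1) ^ (m + 1) * coeff c (vandermondePoly (m + 1) ^ 3 * ∏ i, X i) := by
  have h := coeff_eq_zero_of_mem_highExponentIdeal
    (vandermondePoly_cube_mul_linProd_coeff_mem m (m + 1)) hc
  rw [coeff_linProd_self] at h
  generalize PowerSeries.coeff (m + 1) (linProd (m + 1) ^ 3 *
      (1 + PowerSeries.X * PowerSeries.C (∑ i, X i))) = g at *
  have e : vandermondePoly (m + 1) ^ 3 * (2 * ((((m + 1 : ℕ) : MvPolynomial (Fin (m + 1)) ℤ) + 1) *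
      ((-1) ^ (m + 1) * ∏ i, X i)) - 2 * g) =
      C (2 * ((m : ℤ) + 2) * (-1) ^ (m + 1)) * (vandermondePoly (m + 1) ^ 3 * ∏ i, X i) -
        C 2 * (vandermondePoly (m + 1) ^ 3 * g) := by
    simp only [map_mul, map_add, map_pow, map_neg, map_one, map_natCast, map_ofNat]
    push_cast
    ring
  rw [e, coeff_sub, coeff_C_mul, coeff_C_mul] at h
  linarith

theorem coeff_cons_cons_vandermondePoly_cube {m : ℕ} {c : Fin (m + 1) →₀ ℕ}
    (hc : ∀ i, c i ≤ 2 * (m + 1)) :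
    coeff ((c.cons (2 * m + 3)).cons (3 * m + 5)) (vandermondePoly (m + 3) ^ 3) =
      (-1) ^ m * (3 * ((m : ℤ) + 2)) * coeff c (vandermondePoly (m + 1) ^ 3 * ∏ i, X i) := by
  rw [coeff_cons_vandermondePoly_cube, show 3 * m + 5 = 3 * (m + 1) + 2 by ring,
    coeff_rootProd_cube_next, mul_assoc, show (-3 : MvPolynomial (Fin (m + 2)) ℤ) = C (-3) by simp,
    coeff_C_mul, coeff_cons_mul_vandermondePoly_cube]
  have : (finSuccEquiv ℤ (m + 1) (∑ i, X i) * rootProd (m + 1) ^ 3).coeff (2 * m + 3) =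
      PowerSeries.coeff (m + 1) (linProd (m + 1) ^ 3 *
      (1 + PowerSeries.X * PowerSeries.C (∑ i, X i))) := by
    rw [Fin.sum_univ_succ, map_add, map_sum, finSuccEquiv_X_zero]
    simp only [finSuccEquiv_X_succ]
    rw [← map_sum, add_mul, Polynomial.coeff_add, show 2 * m + 3 = (2 * m + 2) + 1 by ring,
      Polynomial.coeff_X_mul, Polynomial.coeff_C_mul,
      coeff_rootProd_pow (l := m + 1) (by ring), coeff_rootProd_pow (l := m) (by ring),
      mul_add, mul_one, map_add, mul_left_comm, PowerSeries.coeff_succ_X_mul,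
      PowerSeries.coeff_mul_C, mul_comm (∑ i, X i)]
  rw [this, mul_comm, mul_comm (PowerSeries.coeff _ _), coeff_vandermondePoly_cube_mul_linProd hc]
  ring

theorem coeff_vandermondePoly_cube_mul_prod_X {n : ℕ} (c : Fin n →₀ ℕ) :
    coeff (c + Finsupp.equivFunOnFinite.symm fun _ => 1) (vandermondePoly n ^ 3 * ∏ i, X i) =
      coeff (c.cons (3 * n)) (vandermondePoly (n + 1) ^ 3) := by
  have : (∏ i, X i : MvPolynomial (Fin n) ℤ) =
      monomial (Finsupp.equivFunOnFinite.symm fun _ => 1) 1 := by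
    rw [monomial_eq, Finsupp.prod_fintype _ _ (by simp)]
    simp
  rw [this, coeff_mul_monomial, coeff_cons_vandermondePoly_cube, coeff_rootProd_cube_top, one_mul,
    mul_one]

theorem last_part_eq_zero {n : ℕ} {lam : Fin (n + 1) → ℕ} (hanti : Antitone lam)
    (hlen : #{j | lam j ≠ 0} = n) : lam (Fin.last n) = 0 := by
  by_contra h
  have : (Finset.univ.filter fun j => lam j ≠ 0) = univ :=
    Finset.filter_true_of_mem fun j _ => by
      have := hanti (Fin.le_last j)
      omega
  rw [this, Finset.card_univ, Fintype.card_fin] at hlen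
  omega

theorem le_two_mul_of_sum_eq {m : ℕ} {f : Fin (m + 1) → ℕ} (hf : ∀ i, m + 1 ≤ f i)
    (hsum : ∑ i, f i = (m + 2) * (m + 1)) (i : Fin (m + 1)) : f i ≤ 2 * (m + 1) := by
  rw [← Finset.add_sum_erase _ _ (Finset.mem_univ i)] at hsum
  have h := Finset.card_nsmul_le_sum (univ.erase i) f (m + 1) fun j _ => hf j
  rw [Finset.card_erase_of_mem (Finset.mem_univ i), Finset.card_univ, Fintype.card_fin,
    smul_eq_mul, Nat.add_sub_cancel] at h
  nlinarith

/-- adding the tetris shape `L_1(n)` multiplies the coefficient by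
`(-1)^n · 3n`. -/
theorem stmt_16 (n : ℕ) (hn : 2 ≤ n)
    (lam : Fin n → ℕ) (hanti : Antitone lam)
    (hsum : ∑ j, lam j = n * (n - 1))
    (hlen : (Finset.univ.filter fun j => lam j ≠ 0).card = n - 1)
    (hlast : n - 1 ≤ lam ⟨n - 2, by omega⟩) :
    schurCoeff (n + 1) 1
        (fun j : Fin (n + 1) =>
          if h : (j : ℕ) < n - 1 then lam ⟨(j : ℕ), by omega⟩ + 1
          else if (j : ℕ) = n - 1 then n
          else 1) =
      (-1 : ℤ) ^ n * (3 * (n : ℤ)) * schurCoeff n 1 lam := by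
  obtain ⟨m, rfl⟩ : ∃ m, n = m + 2 := ⟨n - 2, by omega⟩
  have hzero : lam (Fin.last (m + 1)) = 0 := last_part_eq_zero hanti hlen
  have hge (i : Fin (m + 1)) : m + 1 ≤ lam i.castSucc :=
    hlast.trans (hanti (Fin.le_def.2 (by simp; omega)))
  have hle (i : Fin (m + 1)) : lam i.castSucc ≤ 2 * (m + 1) := by
    refine le_two_mul_of_sum_eq hge ?_ i
    rwa [Fin.sum_univ_castSucc, hzero, add_zero] at hsum
  set c : Fin (m + 1) →₀ ℕ := Finsupp.equivFunOnFinite.symm fun i =>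
    3 * m + 2 - i - lam (Fin.rev i).castSucc with hc
  have hrhs : schurCoeff (m + 2) 1 lam =
      coeff (c.cons (3 * (m + 1))) (vandermondePoly (m + 2) ^ 3) := by
    refine coeff_vandermondePoly_pow_rev _ _ _ _ fun i => ?_
    refine Fin.cases ?_ (fun i => ?_) i
    · simp [hzero]
    · have h1 := hle (Fin.rev i)
      have h2 := i.2
      simp only [Finsupp.cons_succ, hc, Finsupp.equivFunOnFinite_symm_apply_apply, Fin.rev_succ,
        Fin.val_castSucc, Fin.val_rev]
      omega
  have hlhs : schurCoeff (m + 3) 1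
        (fun j : Fin (m + 3) =>
          if h : (j : ℕ) < m + 2 - 1 then lam ⟨(j : ℕ), by omega⟩ + 1
          else if (j : ℕ) = m + 2 - 1 then m + 2
          else 1) =
      coeff (((c + Finsupp.equivFunOnFinite.symm fun _ => 1).cons (2 * m + 3)).cons (3 * m + 5))
        (vandermondePoly (m + 3) ^ 3) := by
    refine coeff_vandermondePoly_pow_rev _ _ _ _ fun i => ?_
    refine Fin.cases ?_ (fun i => Fin.cases ?_ (fun i => ?_) i) i
    · simp
      omega
    · have h3 : ((Fin.rev (Fin.succ 0) : Fin (m + 3)) : ℕ) = m + 1 := by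
        rw [Fin.val_rev, Fin.val_succ, Fin.val_zero]
        omega
      simp only [Finsupp.cons_succ, Finsupp.cons_zero, Finsupp.equivFunOnFinite_symm_apply_apply, h3]
      rw [dif_neg (by omega), if_pos (by omega)]
      omega
    · have h1 := hle (Fin.rev i)
      have h2 := i.2
      have h3 : ((Fin.rev i.succ.succ : Fin (m + 3)) : ℕ) = m - i := by
        rw [Fin.val_rev, Fin.val_succ, Fin.val_succ]
        omega
      have h4 (h : m - (i : ℕ) < m + 2) : lam ⟨m - i, h⟩ = lam (Fin.rev i).castSucc := by
        congr 1
        ext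
        simp [Fin.val_rev]
      simp only [Finsupp.cons_succ, Finsupp.add_apply, hc,
        Finsupp.equivFunOnFinite_symm_apply_apply, h3, h4]
      rw [dif_pos (by omega)]
      omega
  rw [hlhs, hrhs, coeff_cons_cons_vandermondePoly_cube, coeff_vandermondePoly_cube_mul_prod_X]
  · push_cast
    ring
  · intro i
    have h1 := hge (Fin.rev i)
    simp only [Finsupp.add_apply, hc, Finsupp.equivFunOnFinite_symm_apply_apply]
    omega
end

section
/- Let n ≥ 2 and let λ = (n, (n−1)^{n−2}, n−2) be the partition of n(n−1) with first part n, then n−2 parts equal to n−1, and last part n−2. Then ⟨a_{δ_n}^2, s_λ⟩ = (−1)^{n(n−1)/2 + 1} · (n−1) · 1·3·5 ⋯ (2n−3). -/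
open MvPolynomial Finset

section Dyson

variable {σ : Type*} [DecidableEq σ]

/-- The Dyson product `∏_{i ≠ j} (x_i - x_j)^{a_j}` over the variables in `s`. -/
noncomputable def dysonPoly (s : Finset σ) (a : σ → ℕ) : MvPolynomial σ ℤ :=
  ∏ i ∈ s, ∏ j ∈ s.erase i, (X i - X j) ^ a j

/-- The exponent of the monomial in `dysonPoly s a` corresponding to the constant term of
Dyson's Laurent polynomial. -/
noncomputable def dysonExponent (s : Finset σ) (a : σ → ℕ) : σ →₀ ℕ :=
  ∑ i ∈ s, Finsupp.single i (∑ j ∈ s.erase i, a j)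

lemma dysonExponent_apply (s : Finset σ) (a : σ → ℕ) (i : σ) :
    dysonExponent s a i = if i ∈ s then ∑ j ∈ s.erase i, a j else 0 := by
  simp [dysonExponent, Finsupp.finsetSum_apply, Finsupp.single_apply]

lemma degreeOf_X_sub_X_mul_le {i j : σ} {d : ℕ} {p : MvPolynomial σ ℤ} (hp : degreeOf j p ≤ d) :
    degreeOf j ((X j - X i) * p) ≤ d + 1 := by
  refine (degreeOf_mul_le _ _ _).trans ?_
  have h := degreeOf_sub_le j (X j : MvPolynomial σ ℤ) (X i)
  simp only [degreeOf_X] at h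
  split_ifs at h <;> simp at h <;> omega

lemma coeff_X_sub_X_mul {i j : σ} (hij : i ≠ j) {d : ℕ} {p : MvPolynomial σ ℤ}
    (hp : degreeOf j p ≤ d) (m : σ →₀ ℕ) :
    coeff (m + Finsupp.single j (d + 1)) ((X j - X i) * p) = coeff (m + Finsupp.single j d) p := by
  rw [sub_mul, coeff_sub, coeff_X_mul', coeff_X_mul', if_pos (by simp)]
  have h1 : m + Finsupp.single j (d + 1) - Finsupp.single j 1 = m + Finsupp.single j d := by
    ext k; simp only [Finsupp.coe_tsub, Finsupp.coe_add, Pi.sub_apply, Pi.add_apply,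
      Finsupp.single_apply]; split_ifs <;> omega
  rw [h1, sub_eq_self]
  split_ifs with h
  · rw [← notMem_support_iff]
    apply notMem_support_of_degreeOf_lt j
    simp [hij]; omega
  · rfl

lemma degreeOf_le_and_coeff_X_sub_X_pow_mul {i j : σ} (hij : i ≠ j) {d : ℕ}
    {p : MvPolynomial σ ℤ} (hp : degreeOf j p ≤ d) (m : σ →₀ ℕ) (k : ℕ) :
    degreeOf j ((X j - X i) ^ k * p) ≤ d + k ∧
      coeff (m + Finsupp.single j (d + k)) ((X j - X i) ^ k * p) =
        coeff (m + Finsupp.single j d) p := by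
  induction k with
  | zero => simpa using hp
  | succ k ih =>
    rw [pow_succ', mul_assoc, ← add_assoc]
    exact ⟨degreeOf_X_sub_X_mul_le ih.1, (coeff_X_sub_X_mul hij ih.1 m).trans ih.2⟩

lemma degreeOf_le_and_coeff_prod_X_sub_X_pow_mul {j : σ} {t : Finset σ} (hj : j ∉ t) (a : σ → ℕ)
    {p : MvPolynomial σ ℤ} (hp : degreeOf j p = 0) (m : σ →₀ ℕ) :
    degreeOf j ((∏ i ∈ t, (X j - X i) ^ a i) * p) ≤ ∑ i ∈ t, a i ∧
      coeff (m + Finsupp.single j (∑ i ∈ t, a i)) ((∏ i ∈ t, (X j - X i) ^ a i) * p) =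
        coeff m p := by
  induction t using Finset.induction_on with
  | empty => simp [hp]
  | insert i t hi ih =>
    rw [mem_insert, not_or] at hj
    obtain ⟨h1, h2⟩ := ih hj.2
    rw [prod_insert hi, sum_insert hi, mul_assoc, add_comm (a i)]
    have := degreeOf_le_and_coeff_X_sub_X_pow_mul (Ne.symm hj.1) h1 m (a i)
    exact ⟨this.1, this.2.trans h2⟩

lemma degreeOf_dysonPoly_of_notMem {j : σ} {t : Finset σ} (hj : j ∉ t) (a : σ → ℕ) :
    degreeOf j (dysonPoly t a) = 0 := by
  rw [← Nat.le_zero, dysonPoly]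
  refine (degreeOf_prod_le _ _ _).trans (sum_eq_zero fun i hi => ?_).le
  rw [← Nat.le_zero]
  refine (degreeOf_prod_le _ _ _).trans (sum_eq_zero fun k hk => ?_).le
  rw [← Nat.le_zero]
  refine (degreeOf_pow_le _ _ _).trans ?_
  have h := degreeOf_sub_le j (X i : MvPolynomial σ ℤ) (X k)
  have hk := mem_of_mem_erase hk
  rw [degreeOf_X, degreeOf_X, if_neg (by rintro rfl; exact hj hi),
    if_neg (by rintro rfl; exact hj hk)] at h
  simp at h
  simp [h]

lemma dysonPoly_insert_of_eq_zero {j : σ} {t : Finset σ} (hj : j ∉ t) {a : σ → ℕ}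
    (ha : a j = 0) :
    dysonPoly (insert j t) a = (∏ i ∈ t, (X j - X i) ^ a i) * dysonPoly t a := by
  rw [dysonPoly, prod_insert hj, erase_insert hj, dysonPoly]
  congr 1
  refine prod_congr rfl fun i hi => ?_
  rw [erase_insert_of_ne (by rintro rfl; exact hj hi), prod_insert (by simp [hj]), ha]
  simp

lemma dysonExponent_insert_of_eq_zero {j : σ} {t : Finset σ} (hj : j ∉ t) {a : σ → ℕ}
    (ha : a j = 0) :
    dysonExponent (insert j t) a = dysonExponent t a + Finsupp.single j (∑ i ∈ t, a i) := by
  rw [dysonExponent, sum_insert hj, erase_insert hj, dysonExponent, add_comm]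
  congr 1
  refine sum_congr rfl fun i hi => ?_
  rw [erase_insert_of_ne (by rintro rfl; exact hj hi), sum_insert (by simp [hj]), ha, zero_add]

lemma coeff_dysonPoly_insert_of_eq_zero {j : σ} {t : Finset σ} (hj : j ∉ t) {a : σ → ℕ}
    (ha : a j = 0) :
    coeff (dysonExponent (insert j t) a) (dysonPoly (insert j t) a) =
      coeff (dysonExponent t a) (dysonPoly t a) := by
  rw [dysonPoly_insert_of_eq_zero hj ha, dysonExponent_insert_of_eq_zero hj ha]
  exact (degreeOf_le_and_coeff_prod_X_sub_X_pow_mul hj a (degreeOf_dysonPoly_of_notMem hj a) _).2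

lemma dysonPoly_eq_update_mul {s : Finset σ} {a : σ → ℕ} {k : σ} (hk : k ∈ s) (ha : a k ≠ 0) :
    dysonPoly s a =
      dysonPoly s (Function.update a k (a k - 1)) * ∏ i ∈ s.erase k, (X i - X k) := by
  have h : ∀ i ∈ s, ∏ j ∈ s.erase i, ((X i : MvPolynomial σ ℤ) - X j) ^ a j =
      (∏ j ∈ s.erase i, (X i - X j) ^ Function.update a k (a k - 1) j) *
        if i = k then 1 else X i - X k := by
    intro i hi
    split_ifs with hik
    · subst hik
      rw [mul_one]
      refine prod_congr rfl fun j hj => ?_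
      rw [Function.update_of_ne (ne_of_mem_erase hj)]
    · have hk' : k ∈ s.erase i := mem_erase.2 ⟨Ne.symm hik, hk⟩
      rw [← mul_prod_erase _ _ hk', ← mul_prod_erase _ _ hk', Function.update_self,
        mul_right_comm, ← pow_succ, Nat.sub_add_cancel (Nat.one_le_iff_ne_zero.2 ha)]
      congr 1
      refine prod_congr rfl fun j hj => ?_
      rw [Function.update_of_ne (ne_of_mem_erase hj)]
  rw [dysonPoly, prod_congr rfl h, prod_mul_distrib, dysonPoly]
  congr 1
  rw [← mul_prod_erase _ _ hk, if_pos rfl, one_mul]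
  exact prod_congr rfl fun i hi => if_neg (ne_of_mem_erase hi)

lemma sum_prod_div_sub_eq_one {K : Type*} [Field K] {s : Finset σ} (hs : s.Nonempty) {v : σ → K}
    (hv : Set.InjOn v s) : ∑ k ∈ s, ∏ i ∈ s.erase k, v i / (v i - v k) = 1 := by
  have h := congrArg (Polynomial.eval 0) (Lagrange.sum_basis hv hs)
  rw [Polynomial.eval_finsetSum, Polynomial.eval_one] at h
  rw [← h]
  refine sum_congr rfl fun k hk => ?_
  rw [Lagrange.basis, Polynomial.eval_prod]
  refine prod_congr rfl fun i hi => ?_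
  have : v i - v k ≠ 0 := sub_ne_zero.2 fun h =>
    ne_of_mem_erase hi (hv (mem_of_mem_erase hi) hk h)
  have : v k - v i ≠ 0 := by rwa [← neg_sub, neg_ne_zero]
  simp only [Lagrange.basisDivisor, Polynomial.eval_mul, Polynomial.eval_C, Polynomial.eval_sub,
    Polynomial.eval_X]
  field_simp
  ring

lemma dysonPoly_eq_sum {s : Finset σ} (hs : s.Nonempty) {a : σ → ℕ} (ha : ∀ i ∈ s, a i ≠ 0) :
    dysonPoly s a =
      ∑ k ∈ s, (∏ i ∈ s.erase k, X i) * dysonPoly s (Function.update a k (a k - 1)) := by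
  let K := FractionRing (MvPolynomial σ ℤ)
  let φ := algebraMap (MvPolynomial σ ℤ) K
  have hφ : Function.Injective φ := IsFractionRing.injective _ _
  have hX : Function.Injective fun i : σ => φ (X i) := hφ.comp X_injective
  apply hφ
  rw [map_sum, ← mul_one (φ (dysonPoly s a)), ← sum_prod_div_sub_eq_one hs hX.injOn, mul_sum]
  refine sum_congr rfl fun k hk => ?_
  have h : ∏ i ∈ s.erase k, (φ (X i) - φ (X k)) ≠ 0 := prod_ne_zero_iff.2 fun i hi =>
    sub_ne_zero.2 fun h => ne_of_mem_erase hi (hX h)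
  rw [dysonPoly_eq_update_mul hk (ha k hk), prod_div_distrib, map_mul, map_mul, map_prod, map_prod]
  simp only [map_sub]
  rw [mul_assoc, mul_div_cancel₀ _ h, mul_comm]

lemma dysonExponent_eq_add {s : Finset σ} {a : σ → ℕ} {k : σ} (hk : k ∈ s) (ha : a k ≠ 0) :
    dysonExponent s a = (∑ i ∈ s.erase k, Finsupp.single i 1) +
      dysonExponent s (Function.update a k (a k - 1)) := by
  rw [dysonExponent, dysonExponent, ← add_sum_erase _ _ hk, ← add_sum_erase _ _ hk,
    add_left_comm, ← sum_add_distrib]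
  congr 1
  · congr 1
    exact sum_congr rfl fun j hj => by rw [Function.update_of_ne (ne_of_mem_erase hj)]
  · refine sum_congr rfl fun i hi => ?_
    have hk' : k ∈ s.erase i := mem_erase.2 ⟨(ne_of_mem_erase hi).symm, hk⟩
    rw [← Finsupp.single_add, ← add_sum_erase _ _ hk', ← add_sum_erase _ _ hk',
      Function.update_self, ← add_assoc, Nat.add_sub_cancel' (Nat.one_le_iff_ne_zero.2 ha)]
    congr 2
    exact sum_congr rfl fun j hj => by rw [Function.update_of_ne (ne_of_mem_erase hj)]

lemma coeff_dysonPoly_eq_sum {s : Finset σ} (hs : s.Nonempty) {a : σ → ℕ}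
    (ha : ∀ i ∈ s, a i ≠ 0) :
    coeff (dysonExponent s a) (dysonPoly s a) =
      ∑ k ∈ s, coeff (dysonExponent s (Function.update a k (a k - 1)))
        (dysonPoly s (Function.update a k (a k - 1))) := by
  rw [dysonPoly_eq_sum hs ha, coeff_sum]
  refine sum_congr rfl fun k hk => ?_
  have h : ∏ i ∈ s.erase k, (X i : MvPolynomial σ ℤ) =
      monomial (∑ i ∈ s.erase k, Finsupp.single i 1) 1 := by
    rw [monomial_sum_one]
    rfl
  rw [h, dysonExponent_eq_add hk (ha k hk), coeff_monomial_mul, one_mul]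

/-- Dyson's constant term identity. -/
theorem coeff_dysonPoly_mul_prod_factorial (s : Finset σ) (a : σ → ℕ) :
    coeff (dysonExponent s a) (dysonPoly s a) * ∏ i ∈ s, ((a i).factorial : ℤ) =
      ((∑ i ∈ s, a i).factorial : ℤ) := by
  induction hN : s.card + ∑ i ∈ s, a i using Nat.strong_induction_on generalizing s a with
  | _ N ih =>
  subst hN
  by_cases h0 : ∃ j ∈ s, a j = 0
  · obtain ⟨j, hj, ha⟩ := h0
    obtain ⟨t, hjt, rfl⟩ : ∃ t, j ∉ t ∧ s = insert j t :=
      ⟨s.erase j, notMem_erase _ _, (insert_erase hj).symm⟩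
    rw [coeff_dysonPoly_insert_of_eq_zero hjt ha, prod_insert hjt, sum_insert hjt, ha]
    simpa using ih _ (by rw [card_insert_of_notMem hjt, sum_insert hjt]; omega) t a rfl
  push Not at h0
  obtain rfl | hs := s.eq_empty_or_nonempty
  · simp [dysonPoly, dysonExponent]
  have hsum : ∀ k ∈ s, (∑ i ∈ s, Function.update a k (a k - 1) i) + 1 = ∑ i ∈ s, a i := by
    intro k hk
    have := h0 k hk
    rw [← add_sum_erase _ _ hk, ← add_sum_erase s a hk, Function.update_self,
      sum_congr rfl fun j hj => Function.update_of_ne (ne_of_mem_erase hj) _ _]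
    omega
  have hprod : ∀ k ∈ s, ∏ i ∈ s, ((a i).factorial : ℤ) =
      (a k : ℤ) * ∏ i ∈ s, ((Function.update a k (a k - 1) i).factorial : ℤ) := by
    intro k hk
    rw [← mul_prod_erase _ _ hk, ← mul_prod_erase _ _ hk, Function.update_self, ← mul_assoc]
    congr 1
    · exact_mod_cast (Nat.mul_factorial_pred (h0 k hk)).symm
    · exact prod_congr rfl fun j hj => by rw [Function.update_of_ne (ne_of_mem_erase hj)]
  obtain ⟨M, hM⟩ : ∃ M, ∑ i ∈ s, a i = M + 1 := by
    obtain ⟨k, hk⟩ := hs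
    exact ⟨_, (hsum k hk).symm⟩
  rw [coeff_dysonPoly_eq_sum hs h0, sum_mul, hM, Nat.factorial_succ, ← hM]
  push_cast
  rw [sum_mul]
  refine sum_congr rfl fun k hk => ?_
  have hk' := hsum k hk
  rw [hprod k hk, mul_left_comm, ih _ (by omega) s _ rfl]
  congr 3
  omega

end Dyson

lemma card_filter_lt_fin (n : ℕ) :
    #{p : Fin n × Fin n | p.1 < p.2} = n * (n - 1) / 2 := by
  rw [card_filter, ← univ_product_univ, sum_product]
  simp_rw [← card_filter, filter_lt_eq_Ioi, Fin.card_Ioi]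
  rw [Fin.sum_univ_eq_sum_range (fun i => n - 1 - i), sum_range_reflect (fun i => i), sum_range_id]

lemma vandermondePoly_eq_det (n : ℕ) :
    vandermondePoly n = (-1) ^ (n * (n - 1) / 2) *
      (Matrix.vandermonde (X : Fin n → MvPolynomial (Fin n) ℤ)).det := by
  have h : (Matrix.vandermonde (X : Fin n → MvPolynomial (Fin n) ℤ)).det =
      ∏ p ∈ Finset.univ.filter (fun p : Fin n × Fin n => p.1 < p.2), (X p.2 - X p.1) := by
    rw [Matrix.det_vandermonde, prod_filter, ← univ_product_univ, prod_product]
    simp_rw [← prod_filter, filter_lt_eq_Ioi]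
  rw [h, ← card_filter_lt_fin, ← prod_const, ← prod_mul_distrib, vandermondePoly]
  exact prod_congr rfl fun p _ => by ring

lemma rename_vandermondePoly {n : ℕ} (σ : Equiv.Perm (Fin n)) :
    rename σ (vandermondePoly n) = (Equiv.Perm.sign σ : ℤ) • vandermondePoly n := by
  have h : (rename σ).toRingHom.mapMatrix
      (Matrix.vandermonde (X : Fin n → MvPolynomial (Fin n) ℤ)) =
      (Matrix.vandermonde X).submatrix σ id := by
    ext1 i j
    simp [Matrix.vandermonde_apply]
  rw [vandermondePoly_eq_det, map_mul, map_pow, map_neg, map_one]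
  change _ * (rename σ).toRingHom _ = _
  rw [RingHom.map_det, h, Matrix.det_permute, zsmul_eq_mul]
  ring

lemma coeff_mapDomain_vandermondePoly_pow {n : ℕ} (σ : Equiv.Perm (Fin n)) (m : Fin n →₀ ℕ)
    {k : ℕ} (hk : Odd k) :
    coeff (m.mapDomain σ) (vandermondePoly n ^ k) =
      (Equiv.Perm.sign σ : ℤ) * coeff m (vandermondePoly n ^ k) := by
  have h : rename σ (vandermondePoly n ^ k) =
      (Equiv.Perm.sign σ : ℤ) • vandermondePoly n ^ k := by
    rw [map_pow, rename_vandermondePoly, smul_pow]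
    congr 1
    obtain h | h := Int.units_eq_one_or (Equiv.Perm.sign σ) <;> simp [h, hk.neg_one_pow]
  have h2 := coeff_rename_mapDomain σ σ.injective (vandermondePoly n ^ k) m
  rw [h, coeff_smul, smul_eq_mul] at h2
  rw [← h2, ← mul_assoc]
  obtain h | h := Int.units_eq_one_or (Equiv.Perm.sign σ) <;> simp [h]

lemma coeff_vandermondePoly_pow_eq_zero {n : ℕ} {m : Fin n →₀ ℕ} {i j : Fin n} (hij : i ≠ j)
    (hm : m i = m j) {k : ℕ} (hk : Odd k) : coeff m (vandermondePoly n ^ k) = 0 := by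
  have h := coeff_mapDomain_vandermondePoly_pow (Equiv.swap i j) m hk
  have hmm : m.mapDomain (Equiv.swap i j) = m := by
    ext l
    rw [← Finsupp.equivMapDomain_eq_mapDomain, Finsupp.equivMapDomain_apply, Equiv.symm_swap,
      Equiv.swap_apply_def]
    split_ifs with h1 h2
    · rw [h1, hm]
    · rw [h2, hm]
    · rfl
  rw [hmm, Equiv.Perm.sign_swap hij] at h
  simp at h
  omega

lemma coeff_X_mul_X_mul_pderiv {τ : Type*} [DecidableEq τ] (i : τ) (m : τ →₀ ℕ)
    (p : MvPolynomial τ ℤ) :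
    coeff (m + Finsupp.single i 1) (X i * (X i * pderiv i p)) = (m i : ℤ) * coeff m p := by
  rw [add_comm, coeff_X_mul, coeff_X_mul']
  split_ifs with h
  · have h1 : 1 ≤ m i := Nat.one_le_iff_ne_zero.2 (Finsupp.mem_support_iff.1 h)
    have h2 : m - Finsupp.single i 1 + Finsupp.single i 1 = m :=
      tsub_add_cancel_of_le (Finsupp.single_le_iff.2 h1)
    rw [coeff_pderiv, h2]
    simp
    grind
  · rw [Finsupp.notMem_support_iff] at h
    simp [h]

lemma Derivation.prod_eq_sum_mul_of_eq_mul {R A ι : Type*} [CommRing R] [CommRing A] [Algebra R A]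
    (D : Derivation R A A) (s : Finset ι) (f g : ι → A) (h : ∀ i ∈ s, D (f i) = g i * f i) :
    D (∏ i ∈ s, f i) = (∑ i ∈ s, g i) * ∏ i ∈ s, f i := by
  classical
  induction s using Finset.induction_on with
  | empty => simp
  | insert i s hi ih =>
    rw [prod_insert hi, sum_insert hi, Derivation.leibniz, h i (mem_insert_self _ _),
      ih fun j hj => h j (mem_insert_of_mem hj)]
    simp only [smul_eq_mul]
    ring

lemma sum_filter_lt_add {M : Type*} [CommRing M] (n : ℕ) (f : Fin n → M) :
    ∑ p ∈ Finset.univ.filter (fun p : Fin n × Fin n => p.1 < p.2), (f p.1 + f p.2) =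
      ((n : M) - 1) * ∑ i, f i := by
  rw [sum_add_distrib]
  have h : ∑ p ∈ Finset.univ.filter (fun p : Fin n × Fin n => p.1 < p.2), f p.2 =
      ∑ p ∈ Finset.univ.filter (fun p : Fin n × Fin n => p.2 < p.1), f p.1 :=
    sum_equiv (Equiv.prodComm _ _) (by simp) (by simp)
  rw [h, sum_filter, sum_filter, ← sum_add_distrib, ← univ_product_univ, sum_product, mul_sum]
  refine sum_congr rfl fun i _ => ?_
  have h2 : ∀ j, ((if i < j then f i else 0) + if j < i then f i else 0) =
      f i - if i = j then f i else 0 := by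
    intro j
    obtain h | h | h := lt_trichotomy i j
    · simp [h, h.not_gt, h.ne]
    · simp [h]
    · simp [h, h.not_gt, h.ne']
  simp [h2, sum_sub_distrib]
  ring

lemma sum_X_mul_X_mul_pderiv_vandermondePoly_pow (n k : ℕ) :
    ∑ i, X i * (X i * pderiv i (vandermondePoly n ^ k)) =
      C ((k : ℤ) * ((n : ℤ) - 1)) * ∑ i, X i * vandermondePoly n ^ k := by
  let D : Derivation ℤ (MvPolynomial (Fin n) ℤ) (MvPolynomial (Fin n) ℤ) :=
    ∑ i, (X i * X i : MvPolynomial (Fin n) ℤ) • pderiv i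
  have hD : ∀ p, D p = ∑ i, X i * (X i * pderiv i p) := by
    intro p
    simp only [D, ← Derivation.coeFnAddMonoidHom_apply, map_sum, Finset.sum_apply]
    simp [mul_assoc]
  have hX : ∀ j, D (X j) = X j * X j := by
    intro j
    rw [hD, sum_eq_single j] <;> simp +contextual [pderiv_X, eq_comm]
  have hV : D (vandermondePoly n) = ((n : MvPolynomial (Fin n) ℤ) - 1) * (∑ i, X i) *
      vandermondePoly n := by
    rw [← sum_filter_lt_add, vandermondePoly]
    refine Derivation.prod_eq_sum_mul_of_eq_mul D _ _ _ fun p _ => ?_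
    rw [map_sub, hX, hX]
    ring
  have hV' := Derivation.prod_eq_sum_mul_of_eq_mul D (range k) _ _ fun _ _ => hV
  rw [← hD, ← sum_mul]
  simp only [prod_const, sum_const, card_range] at hV'
  rw [hV']
  simp
  ring

/-- The relation between coefficients of `a_δ^k` obtained from the operator `∑ x_i² ∂_i`, which acts on
`a_δ^k` as multiplication by `k (n - 1) p_1`. -/
lemma sum_mul_coeff_vandermondePoly_pow (n k : ℕ) {m : Fin n →₀ ℕ} (hm : ∀ i, m i ≠ 0) :
    ∑ i, ((m i : ℤ) - 1 - k * ((n : ℤ) - 1)) *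
      coeff (m - Finsupp.single i 1) (vandermondePoly n ^ k) = 0 := by
  have h := congrArg (coeff m) (sum_X_mul_X_mul_pderiv_vandermondePoly_pow n k)
  rw [coeff_C_mul, coeff_sum, coeff_sum, mul_sum] at h
  simp_rw [sub_mul _ (_ * _) (coeff _ _)]
  rw [sum_sub_distrib, sub_eq_zero]
  refine Eq.trans (sum_congr rfl fun i _ => ?_) (h.trans (sum_congr rfl fun i _ => ?_))
  · have hi := hm i
    have h2 : m - Finsupp.single i 1 + Finsupp.single i 1 = m :=
      tsub_add_cancel_of_le (Finsupp.single_le_iff.2 (Nat.one_le_iff_ne_zero.2 hi))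
    rw [← congrArg (fun x => coeff x _) h2, coeff_X_mul_X_mul_pderiv]
    rw [Finsupp.tsub_apply, Finsupp.single_eq_same,
      Nat.cast_sub (Nat.one_le_iff_ne_zero.2 hi), Nat.cast_one, sub_mul, one_mul]
  · rw [coeff_X_mul', if_pos (Finsupp.mem_support_iff.2 (hm i))]

/-- The exponent `((n-1)^n) + δ_n`. -/
noncomputable def rectExponent (n : ℕ) : Fin n →₀ ℕ :=
  Finsupp.equivFunOnFinite.symm fun i => 2 * n - 2 - i

lemma rectExponent_apply (n : ℕ) (i : Fin n) : rectExponent n i = 2 * n - 2 - i := rfl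

lemma vandermondePoly_pow_four_eq_dysonPoly (n : ℕ) :
    vandermondePoly n ^ 4 = dysonPoly univ fun _ => 2 := by
  have h : vandermondePoly n ^ 2 =
      ∏ p ∈ Finset.univ.filter (fun p : Fin n × Fin n => p.2 < p.1), (X p.1 - X p.2) ^ 2 := by
    rw [vandermondePoly, ← prod_pow]
    exact prod_equiv (Equiv.prodComm _ _) (by simp) fun p _ => by simp; ring
  rw [show 4 = 2 + 2 from rfl, pow_add]
  nth_rewrite 2 [h]
  rw [vandermondePoly, ← prod_pow, prod_filter, prod_filter, ← prod_mul_distrib,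
    ← univ_product_univ, prod_product, dysonPoly]
  refine prod_congr rfl fun i _ => ?_
  rw [← filter_ne, prod_filter]
  refine prod_congr rfl fun j _ => ?_
  obtain h | h | h := lt_trichotomy i j
  · simp [h, h.not_gt, h.ne]
  · simp [h]
  · simp [h, h.not_gt, h.ne']

lemma coeff_vandermondePoly_pow_four (n : ℕ) :
    coeff (dysonExponent univ fun _ => 2) (vandermondePoly n ^ 4) =
      (-1 : ℤ) ^ (n * (n - 1) / 2) * (n.factorial * coeff (rectExponent n) (vandermondePoly n ^ 3)) := by
  let e : Fin n →₀ ℕ := Finsupp.equivFunOnFinite.symm fun i => (i : ℕ)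
  have hT : ∀ σ : Equiv.Perm (Fin n), (dysonExponent univ fun _ : Fin n => 2) =
      e.mapDomain σ + (rectExponent n).mapDomain σ := by
    intro σ
    ext i
    rw [dysonExponent_apply, ← Finsupp.mapDomain_add, ← Finsupp.equivMapDomain_eq_mapDomain,
      Finsupp.equivMapDomain_apply]
    simp [e, rectExponent]
    omega
  have hX : ∀ σ : Equiv.Perm (Fin n), ∏ i, (X (σ i) : MvPolynomial (Fin n) ℤ) ^ (i : ℕ) =
      monomial (e.mapDomain σ) 1 := by
    intro σ
    rw [← rename_monomial, monomial_eq, Finsupp.prod_fintype _ _ (by simp)]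
    simp [e]
  have hdet : (Matrix.vandermonde (X : Fin n → MvPolynomial (Fin n) ℤ)).det =
      ∑ σ : Equiv.Perm (Fin n), C (Equiv.Perm.sign σ : ℤ) * monomial (e.mapDomain σ) 1 := by
    rw [Matrix.det_apply']
    refine sum_congr rfl fun σ _ => ?_
    simp only [Matrix.vandermonde_apply, hX]
    simp
  have hC : ((-1) ^ (n * (n - 1) / 2) : MvPolynomial (Fin n) ℤ) =
      C ((-1) ^ (n * (n - 1) / 2)) := by simp
  rw [pow_succ']
  nth_rewrite 1 [vandermondePoly_eq_det n]
  rw [hdet, hC, mul_assoc, coeff_C_mul, sum_mul, coeff_sum]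
  congr 1
  have hterm : ∀ σ : Equiv.Perm (Fin n),
      coeff (dysonExponent univ fun _ : Fin n => 2)
        (C (Equiv.Perm.sign σ : ℤ) * monomial (e.mapDomain σ) 1 * vandermondePoly n ^ 3) =
      coeff (rectExponent n) (vandermondePoly n ^ 3) := by
    intro σ
    rw [mul_assoc, coeff_C_mul, hT σ, coeff_monomial_mul,
      coeff_mapDomain_vandermondePoly_pow σ _ (by decide)]
    obtain h | h := Int.units_eq_one_or (Equiv.Perm.sign σ) <;> simp [h]
  rw [sum_congr rfl fun σ _ => hterm σ]
  simp [Fintype.card_perm]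

/-- The coefficient of the Schur function of the rectangle `((n-1)^n)` in `a_δ²`. -/
theorem coeff_rectExponent (n : ℕ) :
    coeff (rectExponent n) (vandermondePoly n ^ 3) =
      (-1) ^ (n * (n - 1) / 2) * ∏ t ∈ Finset.range n, (2 * (t : ℤ) + 1) := by
  have h := coeff_dysonPoly_mul_prod_factorial (univ : Finset (Fin n)) fun _ => 2
  rw [← vandermondePoly_pow_four_eq_dysonPoly, coeff_vandermondePoly_pow_four] at h
  have hf : ∀ n : ℕ, ((n * 2).factorial : ℤ) =
      2 ^ n * n.factorial * ∏ t ∈ Finset.range n, (2 * (t : ℤ) + 1) := by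
    intro n
    induction n with
    | zero => simp
    | succ n ih =>
      rw [add_mul, one_mul, Nat.factorial_succ, Nat.factorial_succ, Nat.factorial_succ,
        prod_range_succ]
      push_cast
      rw [ih]
      ring
  simp only [sum_const, prod_const, card_univ, Fintype.card_fin, smul_eq_mul, hf] at h
  have hs : ((-1 : ℤ) ^ (n * (n - 1) / 2)) * (-1) ^ (n * (n - 1) / 2) = 1 := by
    rw [← mul_pow]; simp
  have h0 : (2 ^ n * n.factorial : ℤ) ≠ 0 := by positivity
  apply mul_left_cancel₀ h0
  norm_num at h
  linear_combination (-1) ^ (n * (n - 1) / 2) * h -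
    2 ^ n * n.factorial * coeff (rectExponent n) (vandermondePoly n ^ 3) * hs

/-- the coefficient of `s_{(n, (n-1)^{n-2}, n-2)}`. -/
theorem stmt_18 (n : ℕ) (hn : 2 ≤ n) :
    schurCoeff n 1
        (fun j : Fin n =>
          if (j : ℕ) = 0 then n
          else if (j : ℕ) = n - 1 then n - 2
          else n - 1) =
      (-1 : ℤ) ^ (n * (n - 1) / 2 + 1) * ((n : ℤ) - 1) *
        ∏ t ∈ Finset.range (n - 1), (2 * (t : ℤ) + 1) := by
  obtain ⟨k, rfl⟩ : ∃ k, n = k + 2 := ⟨n - 2, by omega⟩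
  have hodd : Odd 3 := by decide
  have h := sum_mul_coeff_vandermondePoly_pow (k + 2) 3
    (m := rectExponent (k + 2) + Finsupp.single 0 1)
    (fun i => by simp [rectExponent]; omega)
  rw [Fin.sum_univ_succ, Fin.sum_univ_castSucc, sum_eq_zero, add_tsub_cancel_right,
    coeff_rectExponent] at h
  · have hlast : rectExponent (k + 2) + Finsupp.single 0 1 -
        Finsupp.single (Fin.last k).succ 1 =
        Finsupp.equivFunOnFinite.symm fun j : Fin (k + 2) =>
          (if (j : ℕ) = 0 then k + 2
          else if (j : ℕ) = k + 2 - 1 then k + 2 - 2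
          else k + 2 - 1) + (k + 2 - 1 - (j : ℕ)) := by
      ext j
      have := j.2
      rw [Finsupp.tsub_apply, Finsupp.add_apply, rectExponent_apply, Finsupp.single_apply,
        Finsupp.single_apply, Finsupp.equivFunOnFinite_symm_apply_apply]
      simp only [Fin.ext_iff, Fin.val_zero, Fin.val_succ, Fin.val_last]
      split_ifs <;> omega
    rw [hlast] at h
    rw [schurCoeff]
    have hfirst_apply : ((rectExponent (k + 2) + Finsupp.single 0 1 : Fin (k + 2) →₀ ℕ) 0 : ℤ) =
        2 * k + 3 := by
      rw [Finsupp.add_apply, rectExponent_apply, Finsupp.single_eq_same, Fin.val_zero]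
      omega
    have hlast_apply : ((rectExponent (k + 2) + Finsupp.single 0 1 : Fin (k + 2) →₀ ℕ)
        (Fin.last k).succ : ℤ) = k + 1 := by
      rw [Finsupp.add_apply, rectExponent_apply, Finsupp.single_eq_of_ne (Fin.succ_ne_zero _),
        Fin.val_succ, Fin.val_last]
      omega
    rw [hfirst_apply, hlast_apply, prod_range_succ] at h
    have h0 : (2 * (k : ℤ) + 3) ≠ 0 := by positivity
    apply mul_left_cancel₀ h0
    rw [show k + 2 - 1 = k + 1 from rfl, pow_succ] at h ⊢
    push_cast at h ⊢
    linear_combination -h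
  · intro i _
    rw [mul_eq_zero]
    right
    refine coeff_vandermondePoly_pow_eq_zero (i := i.castSucc.succ) (j := i.succ.succ)
      (by simp [Fin.ext_iff]) ?_ hodd
    simp [rectExponent, Fin.ext_iff]
    omega
end
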